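/- Suppose K and L are simple polygons in the plane with aco K > −π and aco L > −π. Then the Minkowski sum K + L has no holes: the complement ℝ² ∖ (K + L) is connected (equivalently, K + L is simply connected). -/

import Mathlib

open Real Set Pointwise

noncomputable section

/-- The signed angle from `v` to `w`, in `(-π, π]`; for nonzero non-opposite
vectors it lies in `(-π, π)` and its sign is the sign of the skew product. -/
def vangle (v w : ℝ × ℝ) : ℝ :=
  Complex.arg ((w.1 + w.2 * Complex.I) / (v.1 + v.2 * Complex.I))

/-- `w` is opposite to `v` : `w = a • v` with `a < 0`. -/
def Opp (v w : ℝ × ℝ) : Prop := ∃ a : ℝ, a < 0 ∧ w = a • v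

/-- A shift sequence is non-reverse if no two consecutive shifts are opposite. -/
def NonReverse (s : List (ℝ × ℝ)) : Prop := List.Chain' (fun v w => ¬ Opp v w) s

/-- The rotation of a polyline with the given shift sequence:
the sum of the signed angles between consecutive shifts. -/
def rotShifts : List (ℝ × ℝ) → ℝ
  | v :: w :: rest => vangle v w + rotShifts (w :: rest)
  | _ => 0

/-- The angular convexity of a polyline with shift sequence `s` :
the minimum of the rotations of its contiguous subpolylines. -/
def acoShifts (s : List (ℝ × ℝ)) : ℝ :=
  sInf (rotShifts '' { t : List (ℝ × ℝ) | t <:+: s })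

/-- The (cyclic) rotation of a closed polyline with shift sequence `s`. -/
def rotClosed (s : List (ℝ × ℝ)) : ℝ := rotShifts (s ++ s.take 1)

/-- The angular convexity of a closed polyline with shift sequence `s` :
the minimum of the rotations over all (possibly wrapping) contiguous
subpolylines traversing the cycle at most once, oriented along it. -/
def acoClosed (s : List (ℝ × ℝ)) : ℝ :=
  sInf (rotShifts '' { t : List (ℝ × ℝ) | t.length ≤ s.length ∧ t <:+: (s ++ s) })

/-- A polyline, given by its first vertex and its shift sequence. -/
structure Polyline where
  start : ℝ × ℝ
  shifts : List (ℝ × ℝ)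

namespace Polyline

/-- A genuine polyline: at least one edge and consecutive vertices distinct. -/
def Proper (P : Polyline) : Prop := P.shifts ≠ [] ∧ ∀ v ∈ P.shifts, v ≠ 0

/-- The `i`-th vertex (`0`-indexed). -/
def vert (P : Polyline) (i : ℕ) : ℝ × ℝ := P.start + (P.shifts.take i).sum

/-- The natural piecewise-linear parameterization of `P` on `[0, number of edges]`. -/
def param (P : Polyline) (t : ℝ) : ℝ × ℝ :=
  P.vert ⌊t⌋.toNat + Int.fract t • P.shifts.getD ⌊t⌋.toNat 0

/-- The polyline as a subset of the plane. -/
def trace (P : Polyline) : Set (ℝ × ℝ) := P.param '' Set.Icc 0 (P.shifts.length : ℝ)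

/-- A closed polyline: the last vertex equals the first one. -/
def Closed (P : Polyline) : Prop := P.shifts.sum = 0

/-- A simple (open) polyline: edges may intersect only at a common vertex of
consecutive edges, i.e. the natural parameterization is injective. -/
def Simple (P : Polyline) : Prop := Set.InjOn P.param (Set.Icc 0 (P.shifts.length : ℝ))

/-- A simple closed polyline: closed and injective except for first = last point. -/
def SimpleClosed (P : Polyline) : Prop :=
  P.Closed ∧ Set.InjOn P.param (Set.Ico 0 (P.shifts.length : ℝ))

/-- The `i`-th edge as a segment in the plane. -/
def edge (P : Polyline) (i : ℕ) : Set (ℝ × ℝ) := segment ℝ (P.vert i) (P.vert (i + 1))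

/-- A polyline is in general position if all vertices are distinct, two edges meet
in at most one point which is either the common vertex of consecutive edges or lies
in the relative interiors of both, and no three edges have a common point. -/
def GeneralPosition (P : Polyline) : Prop :=
  (∀ i j, i < j → j ≤ P.shifts.length → P.vert i ≠ P.vert j) ∧
  (∀ i j, i < j → j < P.shifts.length →
    (P.edge i ∩ P.edge j).Subsingleton ∧
    ∀ x ∈ P.edge i ∩ P.edge j,
      (j = i + 1 ∧ x = P.vert j) ∨
      (x ∈ openSegment ℝ (P.vert i) (P.vert (i + 1)) ∧
        x ∈ openSegment ℝ (P.vert j) (P.vert (j + 1)))) ∧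
  ∀ i j k, i < j → j < k → k < P.shifts.length →
    P.edge i ∩ P.edge j ∩ P.edge k = ∅

end Polyline

/-- `P` is the (anticlockwise-oriented) closed simple boundary polyline of the
simple polygon `K`. -/
structure IsSimplePolygon (K : Set (ℝ × ℝ)) (P : Polyline) : Prop where
  compact : IsCompact K
  regular : K = closure (interior K)
  proper : P.Proper
  nonReverse : NonReverse (P.shifts ++ P.shifts.take 1)
  simpleClosed : P.SimpleClosed
  boundary : frontier K = P.trace
  orient : rotClosed P.shifts = 2 * π

/-- The ray with apex `x` and direction `d`. -/
def ray (x d : ℝ × ℝ) : Set (ℝ × ℝ) := {y | ∃ t : ℝ, 0 ≤ t ∧ y = x + t • d}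

/-- The angular region with apex `x` spanned by the directions `u` and `v` :
the convex hull of the two rays. Its angular measure is `|vangle u v|`. -/
def angularRegion (x u v : ℝ × ℝ) : Set (ℝ × ℝ) :=
  convexHull ℝ (ray x u ∪ ray x v)

/-- The merge of two shift sequences used in the sorted sum: repeatedly take the
head of the remaining sequence with the larger rotation (preferring the first). -/
def sortedMerge : List (ℝ × ℝ) → List (ℝ × ℝ) → List (ℝ × ℝ)
  | [], t => t
  | s, [] => s
  | a :: s, b :: t =>
    if rotShifts (b :: t) ≤ rotShifts (a :: s) then a :: sortedMerge s (b :: t)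
    else b :: sortedMerge (a :: s) t
termination_by s t => s.length + t.length

/-- The hypotheses of the sorted sum: both polylines are proper and non-reverse,
their first shifts have the same direction, and their rotations are equal. -/
def SortedSumHyp (P Q : Polyline) : Prop :=
  P.Proper ∧ Q.Proper ∧ NonReverse P.shifts ∧ NonReverse Q.shifts ∧
  vangle P.shifts.headI Q.shifts.headI = 0 ∧
  rotShifts P.shifts = rotShifts Q.shifts

/-- The sorted sum `P +ₛ Q` : starts at the sum of the first vertices and has the
merged shift sequence. -/
def sortedSum (P Q : Polyline) : Polyline :=
  ⟨P.start + Q.start, sortedMerge P.shifts Q.shifts⟩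

namespace MS

/-- `φ` is an argument of `z`. -/
def Ang (z : ℂ) (φ : ℝ) : Prop := z = ‖z‖ * Complex.exp (φ * Complex.I)

lemma ang_of_pos {r φ : ℝ} (hr : 0 ≤ r) : Ang (r * Complex.exp (φ * Complex.I)) φ := by
  unfold Ang
  simp [Complex.norm_exp_ofReal_mul_I, abs_of_nonneg hr]

lemma ang_im {z : ℂ} {φ : ℝ} (h : Ang z φ) (β : ℝ) :
    (z * Complex.exp (-(β * Complex.I))).im = ‖z‖ * Real.sin (φ - β) := by
  unfold Ang at h
  rw [h, mul_assoc, ← Complex.exp_add, ← h]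
  have : (φ * Complex.I + -(β * Complex.I)) = ((φ - β : ℝ) : ℂ) * Complex.I := by
    push_cast; ring
  rw [this, Complex.im_ofReal_mul, Complex.exp_ofReal_mul_I_im]

lemma ang_re {z : ℂ} {φ : ℝ} (h : Ang z φ) (β : ℝ) :
    (z * Complex.exp (-(β * Complex.I))).re = ‖z‖ * Real.cos (φ - β) := by
  unfold Ang at h
  rw [h, mul_assoc, ← Complex.exp_add, ← h]
  have : (φ * Complex.I + -(β * Complex.I)) = ((φ - β : ℝ) : ℂ) * Complex.I := by
    push_cast; ring
  rw [this, Complex.re_ofReal_mul, Complex.exp_ofReal_mul_I_re]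

lemma ang_unique {z : ℂ} {φ ψ : ℝ} (hz : z ≠ 0) (h : Ang z φ) (h' : Ang z ψ) :
    ∃ m : ℤ, φ = ψ + 2 * π * m := by
  have h1 := ang_re h ψ
  have h2 := ang_re h' ψ
  have hn : ‖z‖ ≠ 0 := by simpa using hz
  rw [h1] at h2
  have h3 : Real.cos (φ - ψ) = 1 := by
    have := mul_left_cancel₀ hn h2
    simpa using this
  obtain ⟨m, hm⟩ := (Real.cos_eq_one_iff _).1 h3
  exact ⟨m, by linarith⟩

lemma ang_shift {z : ℂ} {φ : ℝ} (h : Ang z φ) (m : ℤ) : Ang z (φ + 2 * π * m) := by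
  unfold Ang at *
  have : ((φ + 2 * π * m : ℝ) : ℂ) * Complex.I = φ * Complex.I + m * (2 * π * Complex.I) := by
    push_cast; ring
  rw [this, Complex.exp_add, Complex.exp_int_mul_two_pi_mul_I, mul_one]
  exact h

lemma ang_neg {z : ℂ} {φ : ℝ} (h : Ang z φ) : Ang (-z) (φ + π) := by
  unfold Ang at *
  have : ((φ + π : ℝ) : ℂ) * Complex.I = φ * Complex.I + (π * Complex.I) := by
    push_cast; ring
  rw [this, Complex.exp_add, Complex.exp_pi_mul_I, norm_neg]
  rw [mul_neg_one, mul_neg, ← h]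

lemma ang_mul {z w : ℂ} {φ ψ : ℝ} (h : Ang z φ) (h' : Ang w ψ) : Ang (z * w) (φ + ψ) := by
  unfold Ang at *
  have : ((φ + ψ : ℝ) : ℂ) * Complex.I = φ * Complex.I + ψ * Complex.I := by
    push_cast; ring
  rw [this, Complex.exp_add, norm_mul]
  conv_lhs => rw [h, h']
  push_cast; ring

lemma ang_arg (z : ℂ) : Ang z z.arg := by
  unfold Ang
  exact (Complex.norm_mul_exp_arg_mul_I z).symm

/-- A continuous function which takes values in a coset of `2πℤ` is constant. -/
lemma const_of_int {X : Type*} [TopologicalSpace X] {S : Set X} (hS : IsPreconnected S)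
    {f : X → ℝ} (hf : ContinuousOn f S) (c : ℝ)
    (h : ∀ x ∈ S, ∃ m : ℤ, f x = c + 2 * π * m) {x y : X} (hx : x ∈ S) (hy : y ∈ S) :
    f x = f y := by
  by_contra hne
  have key : ∀ x ∈ S, ∀ y ∈ S, ¬ f x < f y := by
    intro x hx y hy hlt
    have himg := (hS.image f hf).ordConnected
    obtain ⟨m, hm⟩ := h x hx
    obtain ⟨l, hl⟩ := h y hy
    have hpi := Real.pi_pos
    have hml : m < l := by
      rw [hm, hl] at hlt
      have : (m : ℝ) < l := by nlinarith
      exact_mod_cast this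
    have hml' : (m : ℝ) + 1 ≤ l := by exact_mod_cast hml
    have hmem : f x + π ∈ Icc (f x) (f y) := by
      constructor
      · linarith
      · rw [hm, hl]; nlinarith
    obtain ⟨w, hw, hwe⟩ := himg.out (mem_image_of_mem f hx) (mem_image_of_mem f hy) hmem
    obtain ⟨q, hq⟩ := h w hw
    rw [hwe, hm] at hq
    have h1 : (2 * (m : ℝ) + 1) = 2 * q := by
      have h2 : π * (2 * (m : ℝ) + 1) = π * (2 * q) := by linarith
      exact mul_left_cancel₀ hpi.ne' h2
    have h2 : 2 * m + 1 = 2 * q := by exact_mod_cast h1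
    omega
  rcases lt_or_gt_of_ne hne with h1 | h1
  · exact key x hx y hy h1
  · exact key y hy x hx h1

/-- Continuous choice of argument on a convex open set. -/
lemma exists_lift {S : Set (ℝ × ℝ)} (hS : Convex ℝ S) (ho : IsOpen S) (hne : S.Nonempty)
    {F : ℝ × ℝ → ℂ} (hF : ContinuousOn F S) (h0 : ∀ x ∈ S, F x ≠ 0) :
    ∃ φ : ℝ × ℝ → ℝ, ContinuousOn φ S ∧ ∀ x ∈ S, Ang (F x) (φ x) := by
  have := hS.contractibleSpace hne
  have : LocallyPathConnectedSpace S := ho.locallyPathConnectedSpace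
  obtain ⟨a, ha⟩ := hne
  let f : C(S, ℂ) := ⟨fun x => F x, hF.domRestrict⟩
  obtain ⟨g, ⟨hg1, hg2⟩, -⟩ := Complex.isCoveringMapOn_exp.existsUnique_continuousMap_lifts f
    (a₀ := ⟨a, ha⟩) (e₀ := Complex.log (F a)) (Complex.exp_log (h0 a ha))
    (fun x => h0 x x.2)
  classical
  refine ⟨fun x => if hx : x ∈ S then (g ⟨x, hx⟩).im else 0, ?_, ?_⟩
  · rw [continuousOn_iff_continuous_domRestrict]
    have : S.domRestrict (fun x => if hx : x ∈ S then (g ⟨x, hx⟩).im else 0) = fun x => (g x).im := by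
      funext x; simp [Set.domRestrict]
    rw [this]
    exact Complex.continuous_im.comp g.continuous
  · intro x hx
    have h1 : Complex.exp (g ⟨x, hx⟩) = F x := congrFun hg2 ⟨x, hx⟩
    simp only [hx, dif_pos]
    unfold Ang
    rw [← h1, Complex.norm_exp]
    push_cast
    rw [← Complex.exp_add, Complex.re_add_im]

end MS

namespace MS

/-- The unit vector with argument `t`. -/
def cis (t : ℝ) : ℂ := Complex.exp (t * Complex.I)

lemma norm_cis (t : ℝ) : ‖cis t‖ = 1 := by simp [cis, Complex.norm_exp_ofReal_mul_I]

lemma cis_ne (t : ℝ) : cis t ≠ 0 := Complex.exp_ne_zero _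

/-- The skew product of `cis t` and `w`. -/
def cr (t : ℝ) (w : ℂ) : ℝ := (w * cis (-t)).im

lemma cr_add (t : ℝ) (w z : ℂ) : cr t (w + z) = cr t w + cr t z := by
  simp only [cr, add_mul, Complex.add_im]

lemma cr_smul (t : ℝ) (c : ℝ) (w : ℂ) : cr t (c * w) = c * cr t w := by
  simp only [cr, mul_assoc, Complex.im_ofReal_mul]

lemma cr_neg (t : ℝ) (w : ℂ) : cr t (-w) = - cr t w := by
  simp [cr]

lemma cr_sub (t : ℝ) (w z : ℂ) : cr t (w - z) = cr t w - cr t z := by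
  rw [sub_eq_add_neg, cr_add, cr_neg, sub_eq_add_neg]

lemma cis_mul (s t : ℝ) : cis s * cis t = cis (s + t) := by
  simp only [cis, ← Complex.exp_add]; congr 1; push_cast; ring

lemma cr_cis (t s : ℝ) : cr t (cis s) = Real.sin (s - t) := by
  rw [cr, cis_mul, cis, Complex.exp_ofReal_mul_I_im, sub_eq_add_neg]

lemma cr_I_cis (t s : ℝ) : cr t (Complex.I * cis s) = Real.cos (s - t) := by
  rw [cr, mul_assoc, cis_mul, Complex.I_mul_im, cis, Complex.exp_ofReal_mul_I_re, sub_eq_add_neg]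

lemma cr_ang {z : ℂ} {φ : ℝ} (h : Ang z φ) (β : ℝ) : cr β z = ‖z‖ * Real.sin (φ - β) := by
  rw [← ang_im h, cr, cis]; simp

lemma cr_continuous (t : ℝ) : Continuous (cr t) := by
  unfold cr; fun_prop

lemma decomp (t : ℝ) (w : ℂ) :
    w = ((w * cis (-t)).re : ℂ) * cis t + (cr t w : ℂ) * (Complex.I * cis t) := by
  have h : cis (-t) * cis t = 1 := by rw [cis_mul]; simp [cis]
  have h2 := Complex.re_add_im (w * cis (-t))
  unfold cr
  calc w = (w * cis (-t)) * cis t := by rw [mul_assoc, h, mul_one]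
    _ = _ := by rw [← h2]; simp only [Complex.add_re, Complex.add_im]; simp; ring

/-- The polygonal curve. -/
def pp (V : ℤ → ℂ) (r θ : ℤ → ℝ) (s : ℝ) : ℂ :=
  V ⌊s⌋ + (Int.fract s : ℝ) * (r ⌊s⌋ * cis (θ ⌊s⌋))

structure PC (K : Set ℂ) (n : ℕ) (V : ℤ → ℂ) (r θ : ℤ → ℝ) : Prop where
  hn : 3 ≤ n
  Vper : ∀ k, V (k + n) = V k
  rpos : ∀ k, 0 < r k
  step : ∀ k, V (k + 1) = V k + r k * cis (θ k)
  tper : ∀ k, θ (k + n) = θ k + 2 * π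
  turn : ∀ k, |θ (k + 1) - θ k| < π
  nodrop : ∀ k l, k ≤ l → θ k - π < θ l
  compact : IsCompact K
  regular : K = closure (interior K)
  fr : frontier K = range (pp V r θ)
  inj : ∀ s s', pp V r θ s = pp V r θ s' → ∃ m : ℤ, s = s' + m * n

variable {K : Set ℂ} {n : ℕ} {V : ℤ → ℂ} {r θ : ℤ → ℝ}

namespace PC

lemma pp_on (h : PC K n V r θ) {k : ℤ} {s : ℝ} (h1 : k ≤ s) (h2 : s ≤ k + 1) :
    pp V r θ s = V k + (s - k : ℝ) * (r k * cis (θ k)) := by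
  rcases h2.lt_or_eq with h2 | h2
  · have : ⌊s⌋ = k := Int.floor_eq_iff.2 ⟨h1, h2⟩
    simp only [pp, Int.fract, this]
  · have : ⌊s⌋ = k + 1 := by rw [h2]; simp
    have h3 : Int.fract s = 0 := by rw [h2]; simp
    simp only [pp, h3, this, h.step]
    rw [h2]; push_cast; ring

lemma pp_int (h : PC K n V r θ) (k : ℤ) : pp V r θ k = V k := by
  rw [h.pp_on (k := k) le_rfl (by linarith)]; simp

lemma pp_edge (h : PC K n V r θ) {k : ℤ} {s s' : ℝ} (h1 : k ≤ s) (h2 : s ≤ k + 1)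
    (h1' : k ≤ s') (h2' : s' ≤ k + 1) :
    pp V r θ s' = pp V r θ s + (s' - s : ℝ) * (r k * cis (θ k)) := by
  rw [h.pp_on h1 h2, h.pp_on h1' h2']; push_cast; ring

lemma floor_lt_add (s : ℝ) : s < (⌊s⌋ : ℝ) + 1 := Int.lt_floor_add_one s

lemma ceil_sub_lt (s : ℝ) : ((⌈s⌉ - 1 : ℤ) : ℝ) < s := by
  have := Int.ceil_lt_add_one s
  push_cast; linarith

lemma pp_right (h : PC K n V r θ) {s s' : ℝ} (h1 : s ≤ s') (h2 : s' ≤ ⌊s⌋ + 1) :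
    pp V r θ s' = pp V r θ s + (s' - s : ℝ) * (r ⌊s⌋ * cis (θ ⌊s⌋)) :=
  h.pp_edge (Int.floor_le s) (floor_lt_add s).le ((Int.floor_le s).trans h1) h2

lemma pp_left (h : PC K n V r θ) {s s' : ℝ} (h1 : s' ≤ s) (h2 : ((⌈s⌉ - 1 : ℤ) : ℝ) ≤ s') :
    pp V r θ s' = pp V r θ s + (s' - s : ℝ) * (r (⌈s⌉ - 1) * cis (θ (⌈s⌉ - 1))) := by
  have h3 : s ≤ ((⌈s⌉ - 1 : ℤ) : ℝ) + 1 := by have := Int.le_ceil s; push_cast; linarith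
  exact h.pp_edge (ceil_sub_lt s).le h3 h2 (h1.trans h3)

lemma loc_eps (s : ℝ) : ∃ ε > 0, ε ≤ 1 ∧ s + ε ≤ ⌊s⌋ + 1 ∧ ((⌈s⌉ - 1 : ℤ) : ℝ) ≤ s - ε := by
  refine ⟨min 1 (min (⌊s⌋ + 1 - s) (s - (⌈s⌉ - 1 : ℤ))), ?_, min_le_left _ _, ?_, ?_⟩
  · have := floor_lt_add s
    have := ceil_sub_lt s
    simp only [gt_iff_lt, lt_min_iff]
    refine ⟨one_pos, by linarith, by linarith⟩
  · have := (min_le_right 1 (min (⌊s⌋ + 1 - s) (s - (⌈s⌉ - 1 : ℤ)))).trans (min_le_left _ _)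
    linarith
  · have := (min_le_right 1 (min (⌊s⌋ + 1 - s) (s - (⌈s⌉ - 1 : ℤ)))).trans (min_le_right _ _)
    linarith

lemma continuous (h : PC K n V r θ) : Continuous (pp V r θ) := by
  rw [continuous_iff_continuousAt]
  intro s
  obtain ⟨ε, hε, -, h1, h2⟩ := loc_eps s
  rw [Metric.continuousAt_iff]
  intro δ hδ
  set C := r ⌊s⌋ + r (⌈s⌉ - 1) with hC
  have hr1 := h.rpos ⌊s⌋
  have hr2 := h.rpos (⌈s⌉ - 1)
  have hCpos : 0 < C := by positivity
  refine ⟨min ε (δ / C), by positivity, ?_⟩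
  intro s' hs'
  rw [Real.dist_eq, lt_min_iff] at hs'
  obtain ⟨ha, hb⟩ := hs'
  rw [lt_div_iff₀ hCpos] at hb
  rw [abs_lt] at ha
  rw [dist_eq_norm]
  rcases le_total s s' with hs | hs
  · rw [h.pp_right hs (by linarith), add_sub_cancel_left, norm_mul, norm_mul, norm_cis,
      Complex.norm_real, Complex.norm_real, Real.norm_eq_abs, Real.norm_eq_abs, abs_of_pos hr1]
    nlinarith [abs_nonneg (s' - s)]
  · rw [h.pp_left hs (by linarith), add_sub_cancel_left, norm_mul, norm_mul, norm_cis,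
      Complex.norm_real, Complex.norm_real, Real.norm_eq_abs, Real.norm_eq_abs, abs_of_pos hr2]
    nlinarith [abs_nonneg (s' - s)]

lemma vper (h : PC K n V r θ) (k : ℤ) :
    (r (k + n) * cis (θ (k + n)) : ℂ) = r k * cis (θ k) := by
  have h1 := h.step (k + n)
  have h2 := h.step k
  rw [h.Vper, show k + (n : ℤ) + 1 = (k + 1) + n by ring, h.Vper] at h1
  rw [h1] at h2
  exact add_left_cancel h2

lemma pper (h : PC K n V r θ) (s : ℝ) : pp V r θ (s + n) = pp V r θ s := by
  have : ⌊s + n⌋ = ⌊s⌋ + n := Int.floor_add_natCast s n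
  simp only [pp, this, h.vper, h.Vper, Int.fract_add_natCast]

lemma pper_int (h : PC K n V r θ) (s : ℝ) (m : ℤ) : pp V r θ (s + m * n) = pp V r θ s := by
  have : Function.Periodic (pp V r θ) (n : ℝ) := h.pper
  exact (this.int_mul m) s

lemma turn' (h : PC K n V r θ) (s : ℝ) : |θ ⌊s⌋ - θ (⌈s⌉ - 1)| < π := by
  by_cases hs : ∃ k : ℤ, (k : ℝ) = s
  · obtain ⟨k, rfl⟩ := hs
    have := h.turn (k - 1)
    simpa using this
  · have h1 : ⌈s⌉ = ⌊s⌋ + 1 := by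
      rw [Int.ceil_eq_iff]
      constructor
      · push_cast
        have := Int.floor_le s
        have h3 : (⌊s⌋ : ℝ) ≠ s := fun h => hs ⟨_, h⟩
        have := lt_of_le_of_ne this h3
        linarith
      · push_cast; exact (floor_lt_add s).le
    rw [h1]; simp [Real.pi_pos]

lemma npos (h : PC K n V r θ) : (0 : ℝ) < n := by
  have := h.hn
  have : 0 < n := by omega
  exact_mod_cast this

/-- `w` is on one of the two rays leaving the curve point with parameter `s`. -/
def OnRay (θ : ℤ → ℝ) (s : ℝ) (w : ℂ) : Prop :=
  ∃ c : ℝ, 0 ≤ c ∧ (w = c * cis (θ ⌊s⌋) ∨ w = -(c * cis (θ (⌈s⌉ - 1))))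

lemma loc (h : PC K n V r θ) (s : ℝ) : ∃ ρ > 0, ∀ w : ℂ, ‖w‖ < ρ →
    (pp V r θ s + w ∈ range (pp V r θ) ↔ OnRay θ s w) := by
  obtain ⟨ε, hε, hε1, h1, h2⟩ := loc_eps s
  have hn3 : (3 : ℝ) ≤ n := by exact_mod_cast h.hn
  have hr1 := h.rpos ⌊s⌋
  have hr2 := h.rpos (⌈s⌉ - 1)
  set C := pp V r θ '' Icc (s + ε) (s + n - ε) with hC
  have hCc : IsCompact C := isCompact_Icc.image h.continuous
  have hnot : pp V r θ s ∉ C := by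
    rintro ⟨s', ⟨ha, hb⟩, hs'⟩
    obtain ⟨m, hm⟩ := h.inj _ _ hs'
    have h3 : (0 : ℝ) < m := by
      by_contra hcon
      have : (m : ℝ) * n ≤ 0 := mul_nonpos_of_nonpos_of_nonneg (not_lt.1 hcon) (by linarith)
      linarith
    have h4 : (m : ℝ) < 1 := by
      by_contra hcon
      have : (n : ℝ) ≤ m * n := by nlinarith [not_lt.1 hcon]
      linarith
    have h5 : (0 : ℤ) < m := by exact_mod_cast h3
    have h6 : m < (1 : ℤ) := by exact_mod_cast h4
    omega
  obtain ⟨ρ, hρ, hball⟩ := Metric.isOpen_iff.1 hCc.isClosed.isOpen_compl _ hnot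
  refine ⟨min ρ (min (ε * r ⌊s⌋) (ε * r (⌈s⌉ - 1))), by positivity, ?_⟩
  intro w hw
  simp only [lt_min_iff] at hw
  obtain ⟨hw1, hw2, hw3⟩ := hw
  constructor
  · rintro ⟨s', hs'⟩
    obtain ⟨m, hm, -⟩ := existsUnique_add_zsmul_mem_Ico (show (0 : ℝ) < n by linarith) s' (s - ε)
    have hs'' : pp V r θ (s' + m • (n : ℝ)) = pp V r θ s + w := by
      rw [zsmul_eq_mul, h.pper_int, hs']
    set u := s' + m • (n : ℝ) with hu
    obtain ⟨hu1, hu2⟩ := hm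
    rcases lt_or_ge u (s + ε) with hlt | hge
    · rcases le_total s u with hsu | hsu
      · rw [h.pp_right hsu (by linarith)] at hs''
        refine ⟨(u - s) * r ⌊s⌋, by have : 0 ≤ u - s := by linarith
                                    positivity, Or.inl ?_⟩
        have := add_left_cancel hs''
        rw [← this]; push_cast; ring
      · rw [h.pp_left hsu (by linarith)] at hs''
        refine ⟨(s - u) * r (⌈s⌉ - 1), by have : 0 ≤ s - u := by linarith
                                          positivity, Or.inr ?_⟩
        have := add_left_cancel hs''
        rw [← this]; push_cast; ring
    · exfalso
      have : pp V r θ s + w ∈ C := ⟨u, ⟨hge, by linarith⟩, hs''⟩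
      refine hball ?_ this
      rw [Metric.mem_ball, dist_eq_norm, add_sub_cancel_left]; exact hw1
  · rintro ⟨c, hc, hcw | hcw⟩
    · have hnw : ‖w‖ = c := by
        rw [hcw, norm_mul, norm_cis, Complex.norm_real, Real.norm_eq_abs, abs_of_nonneg hc, mul_one]
      rw [hnw] at hw2
      refine ⟨s + c / r ⌊s⌋, ?_⟩
      have h3 : c / r ⌊s⌋ < ε := by rw [div_lt_iff₀ hr1]; exact hw2
      have h4 : 0 ≤ c / r ⌊s⌋ := by positivity
      rw [h.pp_right (s := s) (by linarith) (by linarith), hcw]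
      have : (r ⌊s⌋ : ℂ) ≠ 0 := by exact_mod_cast hr1.ne'
      push_cast; field_simp; ring
    · have hnw : ‖w‖ = c := by
        rw [hcw, norm_neg, norm_mul, norm_cis, Complex.norm_real, Real.norm_eq_abs,
          abs_of_nonneg hc, mul_one]
      rw [hnw] at hw3
      refine ⟨s - c / r (⌈s⌉ - 1), ?_⟩
      have h3 : c / r (⌈s⌉ - 1) < ε := by rw [div_lt_iff₀ hr2]; exact hw3
      have h4 : 0 ≤ c / r (⌈s⌉ - 1) := by positivity
      rw [h.pp_left (s := s) (by linarith) (by linarith), hcw]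
      have : (r (⌈s⌉ - 1) : ℂ) ≠ 0 := by exact_mod_cast hr2.ne'
      push_cast; field_simp; ring

end PC
end MS

namespace MS

/-- Right sector at a vertex with incoming direction `α` and outgoing direction `β`. -/
def RS (α β : ℝ) (w : ℂ) : Prop :=
  (α ≤ β ∧ (cr α w < 0 ∨ cr β w < 0)) ∨ (β < α ∧ cr α w < 0 ∧ cr β w < 0)

/-- Left sector at a vertex with incoming direction `α` and outgoing direction `β`. -/
def LS (α β : ℝ) (w : ℂ) : Prop :=
  (α ≤ β ∧ 0 < cr α w ∧ 0 < cr β w) ∨ (β < α ∧ (0 < cr α w ∨ 0 < cr β w))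

/-- The two rays. -/
def Ry (α β : ℝ) (w : ℂ) : Prop := ∃ c : ℝ, 0 ≤ c ∧ (w = c * cis β ∨ w = -(c * cis α))

lemma cr_linear (t : ℝ) : IsLinearMap ℝ (cr t) :=
  ⟨cr_add t, fun c x => by rw [Complex.real_smul, cr_smul]; rfl⟩

lemma eq_of_cr_zero {t : ℝ} {w : ℂ} (h : cr t w = 0) : ∃ c : ℝ, w = c * cis t := by
  refine ⟨(w * cis (-t)).re, ?_⟩
  have := decomp t w
  rw [h] at this
  simpa using this

lemma sin_nonneg_of {α β : ℝ} (h : |β - α| < π) (h1 : α ≤ β) : 0 ≤ Real.sin (β - α) := by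
  rw [abs_lt] at h
  exact Real.sin_nonneg_of_nonneg_of_le_pi (by linarith) (by linarith)

lemma sin_pos_of {α β : ℝ} (h : |β - α| < π) (h1 : α < β) : 0 < Real.sin (β - α) := by
  rw [abs_lt] at h
  exact Real.sin_pos_of_pos_of_lt_pi (by linarith) (by linarith)

lemma tri {α β : ℝ} (h : |β - α| < π) (w : ℂ) : RS α β w ∨ LS α β w ∨ Ry α β w := by
  have h' : |α - β| < π := by rwa [abs_sub_comm]
  have main : ∀ c : ℝ, (w = c * cis α → 0 < cr β w ∨ cr β w < 0 ∨ Ry α β w) ∧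
      (w = c * cis β → 0 < cr α w ∨ cr α w < 0 ∨ Ry α β w) := by
    intro c
    constructor
    · intro _
      rcases lt_trichotomy 0 (cr β w) with h1 | h1 | h1
      · exact Or.inl h1
      · right; right
        obtain ⟨d, hd⟩ := eq_of_cr_zero h1.symm
        by_cases hd0 : 0 ≤ d
        · exact ⟨d, hd0, Or.inl hd⟩
        · rename_i hw
          by_cases hc0 : c ≤ 0
          · exact ⟨-c, by linarith, Or.inr (by rw [hw]; push_cast; ring)⟩
          · exfalso
            have e1 : cr β w = c * Real.sin (α - β) := by rw [hw, cr_smul, cr_cis]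
            rw [← h1] at e1
            have e2 : Real.sin (α - β) = 0 := by
              rcases mul_eq_zero.1 e1.symm with h2 | h2
              · linarith
              · exact h2
            rw [abs_lt] at h'
            have e3 : α - β = 0 := by
              rwa [Real.sin_eq_zero_iff_of_lt_of_lt h'.1 h'.2] at e2
            have e4 : α = β := by linarith
            rw [e4, hd] at hw
            have := mul_right_cancel₀ (cis_ne β) hw
            have : d = c := by exact_mod_cast this
            linarith
      · exact Or.inr (Or.inl h1)
    · intro hw
      rcases lt_trichotomy 0 (cr α w) with h1 | h1 | h1
      · exact Or.inl h1
      · right; right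
        obtain ⟨d, hd⟩ := eq_of_cr_zero h1.symm
        by_cases hd0 : d ≤ 0
        · exact ⟨-d, by linarith, Or.inr (by rw [hd]; push_cast; ring)⟩
        · by_cases hc0 : 0 ≤ c
          · exact ⟨c, hc0, Or.inl hw⟩
          · exfalso
            have e1 : cr α w = c * Real.sin (β - α) := by rw [hw, cr_smul, cr_cis]
            rw [← h1] at e1
            have e2 : Real.sin (β - α) = 0 := by
              rcases mul_eq_zero.1 e1.symm with h2 | h2
              · linarith
              · exact h2
            rw [abs_lt] at h
            have e3 : β - α = 0 := by
              rwa [Real.sin_eq_zero_iff_of_lt_of_lt h.1 h.2] at e2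
            have e4 : β = α := by linarith
            rw [e4, hd] at hw
            have := mul_right_cancel₀ (cis_ne α) hw
            have : d = c := by exact_mod_cast this
            linarith
      · exact Or.inr (Or.inl h1)
  rcases le_or_gt α β with hab | hab
  · by_cases h1 : cr α w < 0
    · exact Or.inl (Or.inl ⟨hab, Or.inl h1⟩)
    by_cases h2 : cr β w < 0
    · exact Or.inl (Or.inl ⟨hab, Or.inr h2⟩)
    right
    by_cases h3 : cr α w = 0
    · obtain ⟨c, hc⟩ := eq_of_cr_zero h3
      rcases (main c).1 hc with h4 | h4 | h4
      · right
        rw [hc, cr_smul, cr_cis] at h4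
        have h5 := sin_nonneg_of h hab
        have h6 : Real.sin (α - β) = - Real.sin (β - α) := by rw [← Real.sin_neg]; ring_nf
        refine ⟨-c, ?_, Or.inr (by rw [hc]; push_cast; ring)⟩
        by_contra hcon
        nlinarith
      · exact absurd h4 h2
      · exact Or.inr h4
    by_cases h3' : cr β w = 0
    · obtain ⟨c, hc⟩ := eq_of_cr_zero h3'
      rcases (main c).2 hc with h4 | h4 | h4
      · right
        rw [hc, cr_smul, cr_cis] at h4
        have h5 := sin_nonneg_of h hab
        refine ⟨c, ?_, Or.inl hc⟩
        by_contra hcon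
        nlinarith
      · exact absurd h4 h1
      · exact Or.inr h4
    · left
      exact Or.inl ⟨hab, lt_of_le_of_ne (not_lt.1 h1) (Ne.symm h3),
        lt_of_le_of_ne (not_lt.1 h2) (Ne.symm h3')⟩
  · by_cases h1 : 0 < cr α w
    · exact Or.inr (Or.inl (Or.inr ⟨hab, Or.inl h1⟩))
    by_cases h2 : 0 < cr β w
    · exact Or.inr (Or.inl (Or.inr ⟨hab, Or.inr h2⟩))
    by_cases h3 : cr α w = 0
    · obtain ⟨c, hc⟩ := eq_of_cr_zero h3
      rcases (main c).1 hc with h4 | h4 | h4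
      · exact absurd h4 h2
      · right; right
        rw [hc, cr_smul, cr_cis] at h4
        have h5 := sin_nonneg_of h' hab.le
        refine ⟨-c, ?_, Or.inr (by rw [hc]; push_cast; ring)⟩
        by_contra hcon
        nlinarith
      · exact Or.inr (Or.inr h4)
    by_cases h3' : cr β w = 0
    · obtain ⟨c, hc⟩ := eq_of_cr_zero h3'
      rcases (main c).2 hc with h4 | h4 | h4
      · exact absurd h4 h1
      · right; right
        rw [hc, cr_smul, cr_cis] at h4
        have h5 := sin_nonneg_of h' hab.le
        have h6 : Real.sin (β - α) = - Real.sin (α - β) := by rw [← Real.sin_neg]; ring_nf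
        refine ⟨c, ?_, Or.inl hc⟩
        by_contra hcon
        nlinarith
      · exact Or.inr (Or.inr h4)
    · left
      exact Or.inr ⟨hab, lt_of_le_of_ne (not_lt.1 h1) h3, lt_of_le_of_ne (not_lt.1 h2) h3'⟩

lemma ry_cr {α β : ℝ} {w : ℂ} (hw : Ry α β w) : ∃ c : ℝ, 0 ≤ c ∧
    ((cr α w = c * Real.sin (β - α) ∧ cr β w = 0) ∨
      (cr α w = 0 ∧ cr β w = c * Real.sin (β - α))) := by
  obtain ⟨c, hc, rfl | rfl⟩ := hw
  · refine ⟨c, hc, Or.inl ⟨by rw [cr_smul, cr_cis], by rw [cr_smul, cr_cis]; simp⟩⟩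
  · refine ⟨c, hc, Or.inr ⟨by rw [cr_neg, cr_smul, cr_cis]; simp, ?_⟩⟩
    rw [cr_neg, cr_smul, cr_cis, show α - β = -(β - α) by ring, Real.sin_neg]; ring

lemma rs_not_ry {α β : ℝ} (h : |β - α| < π) {w : ℂ} (hr : RS α β w) : ¬ Ry α β w := by
  intro hw
  obtain ⟨c, hc, ⟨h1, h2⟩ | ⟨h1, h2⟩⟩ := ry_cr hw
  · rcases hr with ⟨hab, h3⟩ | ⟨hab, h3, h4⟩
    · have := mul_nonneg hc (sin_nonneg_of h hab)
      rcases h3 with h3 | h3 <;> linarith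
    · linarith
  · rcases hr with ⟨hab, h3⟩ | ⟨hab, h3, h4⟩
    · have := mul_nonneg hc (sin_nonneg_of h hab)
      rcases h3 with h3 | h3 <;> linarith
    · linarith

lemma ls_not_ry {α β : ℝ} (h : |β - α| < π) {w : ℂ} (hr : LS α β w) : ¬ Ry α β w := by
  have h' : |α - β| < π := by rwa [abs_sub_comm]
  intro hw
  have h6 : Real.sin (β - α) = - Real.sin (α - β) := by rw [← Real.sin_neg]; ring_nf
  obtain ⟨c, hc, ⟨h1, h2⟩ | ⟨h1, h2⟩⟩ := ry_cr hw
  · rcases hr with ⟨hab, h3, h4⟩ | ⟨hab, h3⟩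
    · linarith
    · have := mul_nonneg hc (sin_nonneg_of h' hab.le)
      rw [h6] at h1
      rcases h3 with h3 | h3 <;> linarith
  · rcases hr with ⟨hab, h3, h4⟩ | ⟨hab, h3⟩
    · linarith
    · have := mul_nonneg hc (sin_nonneg_of h' hab.le)
      rw [h6] at h2
      rcases h3 with h3 | h3 <;> linarith

lemma cos_add_pos {α β : ℝ} (h : |β - α| < π) : 0 < 1 + Real.cos (β - α) := by
  rw [abs_lt] at h
  have h1 : Real.cos (β - α) ≠ -1 := by
    intro h2
    obtain ⟨k, hk⟩ := Real.cos_eq_neg_one_iff.1 h2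
    have hpi := Real.pi_pos
    have h3 : (-1 : ℝ) < k := by nlinarith
    have h4 : (k : ℝ) < 0 := by nlinarith
    have h5 : (-1 : ℤ) < k := by exact_mod_cast h3
    have h6 : k < (0 : ℤ) := by exact_mod_cast h4
    omega
  have h2 := Real.neg_one_le_cos (β - α)
  have := lt_of_le_of_ne h2 (Ne.symm h1)
  linarith

/-- The bisecting normal. -/
def nv (α β : ℝ) : ℂ := Complex.I * cis α + Complex.I * cis β

lemma cr_nv_left {α β : ℝ} : cr α (nv α β) = 1 + Real.cos (β - α) := by
  rw [nv, cr_add, cr_I_cis, cr_I_cis]; simp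

lemma cr_nv_right {α β : ℝ} : cr β (nv α β) = 1 + Real.cos (β - α) := by
  rw [nv, cr_add, cr_I_cis, cr_I_cis, ← Real.cos_neg]; simp [add_comm]

lemma norm_nv_le (α β : ℝ) : ‖nv α β‖ ≤ 2 := by
  refine (norm_add_le _ _).trans ?_
  simp [norm_cis]; norm_num

lemma convex_neg_half (t ρ : ℝ) : Convex ℝ {w : ℂ | ‖w‖ < ρ ∧ cr t w < 0} := by
  have e : {w : ℂ | ‖w‖ < ρ ∧ cr t w < 0} = Metric.ball 0 ρ ∩ {w | cr t w < 0} := by ext w; simp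
  rw [e]
  have h1 := convex_ball (0 : ℂ) ρ
  have h2 := convex_halfSpace_lt (cr_linear t) 0
  exact h1.inter h2

lemma convex_pos_half (t ρ : ℝ) : Convex ℝ {w : ℂ | ‖w‖ < ρ ∧ 0 < cr t w} := by
  have e : {w : ℂ | ‖w‖ < ρ ∧ 0 < cr t w} = Metric.ball 0 ρ ∩ {w | 0 < cr t w} := by ext w; simp
  rw [e]
  have h1 := convex_ball (0 : ℂ) ρ
  have h2 := convex_halfSpace_gt (cr_linear t) 0
  exact h1.inter h2

lemma small_nv (α β : ℝ) {δ ρ : ℝ} (h0 : 0 < δ) (h : δ < ρ / 2) : ‖(δ : ℂ) * nv α β‖ < ρ := by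
  rw [norm_mul, Complex.norm_real, Real.norm_eq_abs, abs_of_pos h0]
  have := norm_nv_le α β
  nlinarith

lemma rs_preconn {α β : ℝ} (h : |β - α| < π) {ρ : ℝ} (hρ : 0 < ρ) :
    IsPreconnected {w : ℂ | ‖w‖ < ρ ∧ RS α β w} := by
  have hp := cos_add_pos h
  rcases le_or_gt α β with hab | hab
  · have : {w : ℂ | ‖w‖ < ρ ∧ RS α β w} =
        {w : ℂ | ‖w‖ < ρ ∧ cr α w < 0} ∪ {w : ℂ | ‖w‖ < ρ ∧ cr β w < 0} := by
      ext w; simp only [RS, hab, not_lt.2 hab, mem_ofPred_eq, mem_union]; tauto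
    rw [this]
    have hs := small_nv α β (δ := ρ / 4) (ρ := ρ) (by linarith) (by linarith)
    refine IsPreconnected.union (-(((ρ / 4 : ℝ) : ℂ) * nv α β)) ⟨?_, ?_⟩ ⟨?_, ?_⟩
      (convex_neg_half α ρ).isPreconnected (convex_neg_half β ρ).isPreconnected
    · rwa [norm_neg]
    · rw [cr_neg, cr_smul, cr_nv_left]; nlinarith
    · rwa [norm_neg]
    · rw [cr_neg, cr_smul, cr_nv_right]; nlinarith
  · have : {w : ℂ | ‖w‖ < ρ ∧ RS α β w} =
        {w : ℂ | ‖w‖ < ρ ∧ cr α w < 0} ∩ {w : ℂ | ‖w‖ < ρ ∧ cr β w < 0} := by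
      ext w; simp only [RS, hab, not_le.2 hab, mem_ofPred_eq, mem_inter_iff]; tauto
    rw [this]
    exact ((convex_neg_half α ρ).inter (convex_neg_half β ρ)).isPreconnected

lemma ls_preconn {α β : ℝ} (h : |β - α| < π) {ρ : ℝ} (hρ : 0 < ρ) :
    IsPreconnected {w : ℂ | ‖w‖ < ρ ∧ LS α β w} := by
  have hp := cos_add_pos h
  rcases le_or_gt α β with hab | hab
  · have : {w : ℂ | ‖w‖ < ρ ∧ LS α β w} =
        {w : ℂ | ‖w‖ < ρ ∧ 0 < cr α w} ∩ {w : ℂ | ‖w‖ < ρ ∧ 0 < cr β w} := by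
      ext w; simp only [LS, hab, not_lt.2 hab, mem_ofPred_eq, mem_inter_iff]; tauto
    rw [this]
    exact ((convex_pos_half α ρ).inter (convex_pos_half β ρ)).isPreconnected
  · have : {w : ℂ | ‖w‖ < ρ ∧ LS α β w} =
        {w : ℂ | ‖w‖ < ρ ∧ 0 < cr α w} ∪ {w : ℂ | ‖w‖ < ρ ∧ 0 < cr β w} := by
      ext w; simp only [LS, hab, not_le.2 hab, mem_ofPred_eq, mem_union]; tauto
    rw [this]
    have hs := small_nv α β (δ := ρ / 4) (ρ := ρ) (by linarith) (by linarith)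
    refine IsPreconnected.union ((((ρ / 4 : ℝ) : ℂ) * nv α β)) ⟨hs, ?_⟩ ⟨hs, ?_⟩
      (convex_pos_half α ρ).isPreconnected (convex_pos_half β ρ).isPreconnected
    · rw [cr_smul, cr_nv_left]; positivity
    · rw [cr_smul, cr_nv_right]; positivity

lemma cos_or {α β γ : ℝ} (h : |β - α| < π) (h1 : (α ≤ γ ∧ γ ≤ β) ∨ (β ≤ γ ∧ γ ≤ α)) :
    0 < Real.cos (γ - α) ∨ 0 < Real.cos (γ - β) := by
  rw [abs_lt] at h
  by_contra hcon
  push Not at hcon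
  obtain ⟨h2, h3⟩ := hcon
  have h4 : π / 2 ≤ |γ - α| := by
    by_contra hc
    rw [not_le, abs_lt] at hc
    linarith [Real.cos_pos_of_mem_Ioo ⟨hc.1, hc.2⟩]
  have h5 : π / 2 ≤ |γ - β| := by
    by_contra hc
    rw [not_le, abs_lt] at hc
    linarith [Real.cos_pos_of_mem_Ioo ⟨hc.1, hc.2⟩]
  rcases h1 with ⟨h6, h7⟩ | ⟨h6, h7⟩
  · rw [abs_of_nonneg (by linarith)] at h4
    rw [abs_of_nonpos (by linarith)] at h5
    linarith
  · rw [abs_of_nonpos (by linarith)] at h4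
    rw [abs_of_nonneg (by linarith)] at h5
    linarith

lemma rs_normal {α β γ δ : ℝ} (h : |β - α| < π) (h1 : α ≤ γ) (h2 : γ ≤ β) (hδ : 0 < δ) :
    RS α β (-(δ * (Complex.I * cis γ))) := by
  left
  refine ⟨h1.trans h2, ?_⟩
  rw [cr_neg, cr_neg, cr_smul, cr_smul, cr_I_cis, cr_I_cis]
  rcases cos_or h (Or.inl ⟨h1, h2⟩) with h3 | h3
  · left; nlinarith
  · right; nlinarith

lemma ls_normal {α β γ δ : ℝ} (h : |β - α| < π) (h1 : β ≤ γ) (h2 : γ ≤ α) (hδ : 0 < δ) :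
    LS α β (δ * (Complex.I * cis γ)) := by
  rcases (h1.trans h2).lt_or_eq with h3 | h3
  · right
    refine ⟨h3, ?_⟩
    rw [cr_smul, cr_smul, cr_I_cis, cr_I_cis]
    rcases cos_or h (Or.inr ⟨h1, h2⟩) with h3 | h3
    · left; positivity
    · right; positivity
  · have h4 : γ = β := by linarith
    subst h4; subst h3
    left
    rw [cr_smul, cr_I_cis]; simpa using hδ

end MS

namespace MS

lemma cis_zero : cis 0 = 1 := by simp [cis]

lemma arg_cis {ρ δ : ℝ} (hρ : 0 < ρ) (h : |δ| < π) : Complex.arg (ρ * cis δ) = δ := by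
  rw [abs_lt] at h
  rw [Complex.arg_real_mul _ hρ, cis, Complex.arg_exp_mul_I]
  exact toIocMod_eq_self _ |>.2 ⟨h.1, by linarith⟩

lemma slit_seg {ρ δ τ : ℝ} (hρ : 0 < ρ) (h : |δ| < π) (h0 : 0 ≤ τ) (h1 : τ ≤ 1) :
    ((1 - τ : ℝ) : ℂ) + τ * (ρ * cis δ) ∈ Complex.slitPlane := by
  have hz : (ρ * cis δ : ℂ) ∈ Complex.slitPlane := by
    rw [Complex.mem_slitPlane_iff_arg, arg_cis hρ h]
    refine ⟨?_, mul_ne_zero (by exact_mod_cast hρ.ne') (cis_ne _)⟩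
    rintro rfl
    rw [abs_of_pos Real.pi_pos] at h
    exact lt_irrefl _ h
  have := Complex.starConvex_one_slitPlane hz (a := 1 - τ) (b := τ) (by linarith) h0 (by ring)
  simpa using this

lemma ang_cis {r φ : ℝ} (hr : 0 ≤ r) : Ang (r * cis φ) φ := ang_of_pos hr

variable {K : Set ℂ} {n : ℕ} {V : ℤ → ℂ} {r θ : ℤ → ℝ}

namespace PC

/-- The parameter domain of chords. -/
def TT (n : ℕ) : Set (ℝ × ℝ) := {x | x.1 < x.2 ∧ x.2 < x.1 + n}

lemma TT_convex (n : ℕ) : Convex ℝ (TT n) := by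
  rintro ⟨a, b⟩ ⟨h1, h2⟩ ⟨c, d⟩ ⟨h3, h4⟩ u v hu hv huv
  simp only at h1 h2 h3 h4
  have hv' : v = 1 - u := by linarith
  subst hv'
  simp only [TT, mem_ofPred_eq, Prod.smul_mk, Prod.mk_add_mk, smul_eq_mul]
  rcases hu.eq_or_lt with rfl | hu
  · constructor <;> linarith
  · constructor <;> nlinarith

lemma TT_open (n : ℕ) : IsOpen (TT n) :=
  (isOpen_lt continuous_fst continuous_snd).inter
    (isOpen_lt continuous_snd (continuous_fst.add continuous_const))

lemma chord_ne (h : PC K n V r θ) {x : ℝ × ℝ} (hx : x ∈ TT n) :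
    pp V r θ x.2 - pp V r θ x.1 ≠ 0 := by
  intro h0
  obtain ⟨m, hm⟩ := h.inj _ _ (sub_eq_zero.1 h0)
  obtain ⟨h1, h2⟩ := hx
  have hn := h.npos
  have h3 : (0 : ℝ) < m := by
    by_contra hcon
    have : (m : ℝ) * n ≤ 0 := mul_nonpos_of_nonpos_of_nonneg (not_lt.1 hcon) (by linarith)
    linarith
  have h4 : (m : ℝ) < 1 := by
    by_contra hcon
    have : (n : ℝ) ≤ m * n := by nlinarith [not_lt.1 hcon]
    linarith
  have h5 : (0 : ℤ) < m := by exact_mod_cast h3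
  have h6 : m < (1 : ℤ) := by exact_mod_cast h4
  omega

/-- The edge parameter domain. -/
def EE (k : ℤ) : Set (ℝ × ℝ) := {x | k ≤ x.1 ∧ x.1 < x.2 ∧ x.2 ≤ k + 1}

lemma EE_convex (k : ℤ) : Convex ℝ (EE k) := by
  rintro ⟨a, b⟩ ⟨h1, h2, h3⟩ ⟨c, d⟩ ⟨h4, h5, h6⟩ u v hu hv huv
  simp only at h1 h2 h3 h4 h5 h6
  have hv' : v = 1 - u := by linarith
  subst hv'
  simp only [EE, mem_ofPred_eq, Prod.smul_mk, Prod.mk_add_mk, smul_eq_mul]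
  rcases hu.eq_or_lt with rfl | hu
  · refine ⟨?_, ?_, ?_⟩ <;> linarith
  · refine ⟨?_, ?_, ?_⟩ <;> nlinarith

lemma EE_sub (h : PC K n V r θ) (k : ℤ) : EE k ⊆ TT n := by
  rintro x ⟨h1, h2, h3⟩
  have hn3 : (3 : ℝ) ≤ n := by exact_mod_cast h.hn
  exact ⟨h2, by linarith⟩

lemma hopf_pre (h : PC K n V r θ) : ∃ c : ℝ × ℝ → ℝ, ContinuousOn c (TT n) ∧
    (∀ x ∈ TT n, Ang (pp V r θ x.2 - pp V r θ x.1) (c x)) ∧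
    (∀ k : ℤ, ∀ x ∈ EE k, c x = θ k) := by
  have hn3 : (3 : ℝ) ≤ n := by exact_mod_cast h.hn
  have hne : (TT n).Nonempty := ⟨(0, 1), by constructor <;> simp only <;> linarith⟩
  obtain ⟨c, hc, hA⟩ := exists_lift (TT_convex n) (TT_open n) hne
    (F := fun x => pp V r θ x.2 - pp V r θ x.1)
    (((h.continuous.comp continuous_snd).sub (h.continuous.comp continuous_fst)).continuousOn)
    (fun x hx => h.chord_ne hx)
  have mid : ∀ k : ℤ, ((k : ℝ), (k : ℝ) + 1) ∈ EE k := fun k => ⟨by simp, by simp, by simp⟩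
  have s1 : ∀ k : ℤ, ∃ m : ℤ, ∀ x ∈ EE k, c x = θ k + 2 * π * m := by
    intro k
    have e1 : ∀ x ∈ EE k, ∃ m : ℤ, c x = θ k + 2 * π * m := by
      intro x hx
      have hxT := h.EE_sub k hx
      refine ang_unique (h.chord_ne hxT) (hA x hxT) ?_
      obtain ⟨h1, h2, h3⟩ := hx
      rw [h.pp_edge h1 (by linarith) (by linarith) h3, add_sub_cancel_left, ← mul_assoc]
      rw [← Complex.ofReal_mul]
      exact ang_cis (mul_nonneg (by linarith) (h.rpos k).le)
    obtain ⟨m, hm⟩ := e1 _ (mid k)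
    refine ⟨m, fun x hx => ?_⟩
    rw [← hm]
    exact const_of_int (EE_convex k).isPreconnected (hc.mono (h.EE_sub k)) (θ k) e1 hx (mid k)
  choose M hM using s1
  have s2 : ∀ k, M (k + 1) = M k := by
    intro k
    set δ := θ (k + 1) - θ k with hδ
    have hδ' : |δ| < π := h.turn k
    set ρ := r (k + 1) / r k with hρ
    have hρ' : 0 < ρ := div_pos (h.rpos _) (h.rpos _)
    let q : ℝ → ℂ := fun τ => ((1 - τ : ℝ) : ℂ) + τ * (ρ * cis δ)
    let f : ℝ → ℝ := fun τ => c (k + τ, k + 1 + τ) - (θ k + Complex.arg (q τ))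
    have hT : ∀ τ ∈ Icc (0 : ℝ) 1, ((k : ℝ) + τ, (k : ℝ) + 1 + τ) ∈ TT n := by
      intro τ hτ
      constructor <;> simp; linarith
    have hf : ContinuousOn f (Icc 0 1) := by
      refine ContinuousOn.sub (hc.comp (by fun_prop) hT) (continuousOn_const.add ?_)
      intro τ hτ
      have h1 := Complex.continuousAt_arg (slit_seg hρ' hδ' hτ.1 hτ.2)
      have h2 : Continuous q := by fun_prop
      exact (ContinuousAt.comp (f := q) h1 h2.continuousAt).continuousWithinAt
    have hv : ∀ τ ∈ Icc (0 : ℝ) 1, ∃ m : ℤ, f τ = 0 + 2 * π * m := by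
      intro τ hτ
      have e1 : pp V r θ (k + 1 + τ) - pp V r θ (k + τ) = (r k * cis (θ k)) * q τ := by
        have := h.pp_on (k := k + 1) (s := k + 1 + τ) (by push_cast; linarith [hτ.1])
          (by push_cast; linarith [hτ.2])
        rw [this, h.pp_on (k := k) (s := k + τ) (by linarith [hτ.1]) (by linarith [hτ.2]), h.step]
        have e2 : cis (θ (k + 1)) = cis (θ k) * cis δ := by
          rw [cis_mul, hδ]; ring_nf
        have e3 : (r (k + 1) : ℂ) = r k * ρ := by
          rw [hρ]; push_cast
          have : (r k : ℂ) ≠ 0 := by exact_mod_cast (h.rpos k).ne'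
          field_simp
        rw [e2, e3]
        simp only [q]
        push_cast; ring
      obtain ⟨m, hm⟩ := ang_unique (h.chord_ne (hT τ hτ)) (hA _ (hT τ hτ))
        (by simp only; rw [e1]; exact ang_mul (ang_cis (h.rpos k).le) (ang_arg (q τ)))
      exact ⟨m, by simp only [f]; rw [hm]; ring⟩
    have := const_of_int isPreconnected_Icc hf 0 hv (x := 0) (y := 1) (by simp) (by simp)
    have q0 : q 0 = 1 := by simp [q]
    have q1 : q 1 = ρ * cis δ := by simp [q]
    simp only [f, q0, q1, Complex.arg_one, arg_cis hρ' hδ'] at this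
    have m1 := hM k _ (mid k)
    have m2 := hM (k + 1) _ (mid (k + 1))
    push_cast at m2
    simp only [add_zero] at this
    rw [m1, m2] at this
    have : 2 * π * ((M (k + 1) : ℝ) - M k) = 0 := by rw [hδ] at this; linarith
    have h2 : (M (k + 1) : ℝ) - M k = 0 := by
      rcases mul_eq_zero.1 this with h3 | h3
      · linarith [Real.pi_pos]
      · exact h3
    have : (M (k + 1) : ℝ) = M k := by linarith
    exact_mod_cast this
  have s3 : ∀ k, M k = M 0 := by
    intro k
    induction k using Int.induction_on with
    | zero => rfl
    | succ i ih => rw [s2, ih]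
    | pred i ih => rw [← ih, ← s2]; ring_nf
  refine ⟨fun x => c x + 2 * π * ((-M 0 : ℤ) : ℝ), hc.add continuousOn_const, ?_, ?_⟩
  · intro x hx
    exact ang_shift (hA x hx) _
  · intro k x hx
    simp only
    rw [hM k x hx, s3 k]; push_cast; ring

lemma hopf (h : PC K n V r θ) : ∃ c : ℝ × ℝ → ℝ, ContinuousOn c (TT n) ∧
    (∀ x ∈ TT n, Ang (pp V r θ x.2 - pp V r θ x.1) (c x)) ∧
    (∀ k : ℤ, ∀ x ∈ EE k, c x = θ k) ∧ (∀ x ∈ TT n, c (x.2, x.1 + n) = c x + π) := by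
  obtain ⟨c, hc, hA, hE⟩ := h.hopf_pre
  have hn3 : (3 : ℝ) ≤ n := by exact_mod_cast h.hn
  refine ⟨c, hc, hA, hE, ?_⟩
  have hT : ∀ x ∈ TT n, (x.2, x.1 + (n : ℝ)) ∈ TT n := by
    rintro x ⟨h1, h2⟩
    constructor <;> simp only <;> linarith
  let g : ℝ × ℝ → ℝ := fun x => c (x.2, x.1 + n) - c x
  have hg : ContinuousOn g (TT n) := (hc.comp (by fun_prop) hT).sub hc
  have hv : ∀ x ∈ TT n, ∃ m : ℤ, g x = π + 2 * π * m := by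
    intro x hx
    obtain ⟨m, hm⟩ := ang_unique (φ := c (x.2, x.1 + n)) (ψ := c x + π)
      (neg_ne_zero.2 (h.chord_ne hx)) (by
        have := hA _ (hT x hx)
        simp only [h.pper] at this
        rwa [neg_sub]) (ang_neg (hA x hx))
    exact ⟨m, by simp only [g]; rw [hm]; ring⟩
  have key : ∀ x ∈ TT n, ∀ y ∈ TT n, g x = g y := fun x hx y hy =>
    const_of_int (TT_convex n).isPreconnected hg π hv hx hy
  have h01 : ((0 : ℝ), (1 : ℝ)) ∈ EE 0 := ⟨by simp, by simp, by simp⟩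
  have hnn : ((0 : ℝ) + n, (1 : ℝ) + n) ∈ EE (0 + n) := by
    refine ⟨by simp, by simp, by push_cast; linarith⟩
  have e1 := hE _ _ h01
  have e2 := hE _ _ hnn
  rw [h.tper] at e2
  have h01' := h.EE_sub 0 h01
  have e3 := key _ h01' _ (hT _ h01')
  simp only [g] at e3
  have e4 : c (1, 0 + n) - c (0, 1) = π := by linarith
  intro x hx
  have := key x hx _ h01'
  simp only [g] at this
  linarith

lemma exists_bottom (h : PC K n V r θ) : ∃ k : ℤ, ∀ s, (V k).im ≤ (pp V r θ s).im := by
  have hn : 0 < n := by have := h.hn; omega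
  obtain ⟨k, -, hk⟩ := Finset.exists_min_image (Finset.range n) (fun i : ℕ => (V i).im)
    ⟨0, by simpa using hn⟩
  have hV : Function.Periodic V (n : ℤ) := h.Vper
  have hall : ∀ j : ℤ, (V k).im ≤ (V j).im := by
    intro j
    have h1 : V j = V (j % n) := by
      have := hV.int_mul (j / n) (j % n)
      rw [← this]; congr 1
      have := Int.emod_add_mul_ediv j n
      simp only [Int.cast_id]
      linarith
    have h2 : 0 ≤ j % n := Int.emod_nonneg _ (by omega)
    have h3 : j % n < n := Int.emod_lt_of_pos _ (by omega)
    obtain ⟨i, hi⟩ := Int.eq_ofNat_of_zero_le h2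
    rw [h1, hi]
    exact hk i (by simp; omega)
  refine ⟨k, fun s => ?_⟩
  have e : pp V r θ s = ((1 - Int.fract s : ℝ) : ℂ) * V ⌊s⌋ + (Int.fract s : ℝ) * V (⌊s⌋ + 1) := by
    rw [h.step, pp]; push_cast; ring
  rw [e, Complex.add_im, Complex.im_ofReal_mul, Complex.im_ofReal_mul]
  have := hall ⌊s⌋
  have := hall (⌊s⌋ + 1)
  have := Int.fract_nonneg s
  have := (Int.fract_lt_one s).le
  nlinarith

lemma sin_range {S : Set ℝ} (hS : IsPreconnected S) {f : ℝ → ℝ} (hf : ContinuousOn f S)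
    (h0 : ∀ x ∈ S, 0 ≤ Real.sin (f x)) {x0 : ℝ} (hx0 : x0 ∈ S) : ∃ m : ℤ, ∀ x ∈ S,
    2 * π * m ≤ f x ∧ f x ≤ 2 * π * m + π := by
  have hpi := Real.pi_pos
  have hneg : ∀ (m : ℤ) (y : ℝ), 2 * π * m - π < y → y < 2 * π * m → Real.sin y < 0 := by
    intro m y h1 h2
    have : Real.sin (y - m * (2 * π)) = Real.sin y := Real.sin_sub_int_mul_two_pi y m
    rw [← this]
    exact Real.sin_neg_of_neg_of_neg_pi_lt (by linarith) (by linarith)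
  have hoc := (hS.image f hf).ordConnected
  refine ⟨⌊f x0 / (2 * π)⌋, ?_⟩
  set m := ⌊f x0 / (2 * π)⌋ with hm
  have h1 : 2 * π * m ≤ f x0 := by
    have := Int.floor_le (f x0 / (2 * π))
    rw [le_div_iff₀ (by positivity)] at this
    linarith
  have h2 : f x0 < 2 * π * m + 2 * π := by
    have := Int.lt_floor_add_one (f x0 / (2 * π))
    rw [div_lt_iff₀ (by positivity)] at this
    rw [← hm] at this
    linarith
  have no : ∀ x ∈ S, ∀ y, y ∈ Set.uIcc (f x0) (f x) → 0 ≤ Real.sin y := by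
    intro x hx y hy
    obtain ⟨z, hz, rfl⟩ := hoc.uIcc_subset (mem_image_of_mem f hx0) (mem_image_of_mem f hx) hy
    exact h0 z hz
  have h3 : f x0 ≤ 2 * π * m + π := by
    by_contra hcon
    have := hneg (m + 1) (f x0) (by push_cast; linarith) (by push_cast; linarith)
    linarith [h0 x0 hx0]
  intro x hx
  constructor
  · by_contra hcon
    push Not at hcon
    have h5 := hneg m ((2 * π * m + max (f x) (2 * π * m - π)) / 2)
      (by have := le_max_right (f x) (2 * π * m - π); linarith)
      (by have : max (f x) (2 * π * m - π) < 2 * π * m := max_lt hcon (by linarith)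
          linarith)
    have h6 := no x hx ((2 * π * m + max (f x) (2 * π * m - π)) / 2) (Set.mem_uIcc.2 (Or.inr ⟨by
      have := le_max_left (f x) (2 * π * m - π); linarith, by
      have : max (f x) (2 * π * m - π) < 2 * π * m := max_lt hcon (by linarith)
      linarith⟩))
    linarith
  · by_contra hcon
    push Not at hcon
    set z := min (f x) (2 * π * m + 2 * π)
    have z1 : z ≤ f x := min_le_left _ _
    have z2 : z ≤ 2 * π * m + 2 * π := min_le_right _ _
    have z3 : 2 * π * m + π < z := lt_min hcon (by linarith)
    have h5 := hneg (m + 1) ((2 * π * m + π + z) / 2) (by push_cast; linarith)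
      (by push_cast; linarith)
    have h6 := no x hx ((2 * π * m + π + z) / 2) (Set.mem_uIcc.2 (Or.inl ⟨by linarith, by linarith⟩))
    linarith

lemma bottom (h : PC K n V r θ) : ∃ k m : ℤ, (∀ s, (V k).im ≤ (pp V r θ s).im) ∧
    θ (k - 1) ≤ 2 * π * m ∧ 2 * π * m ≤ θ k := by
  obtain ⟨k, hk⟩ := h.exists_bottom
  obtain ⟨c, hc, hA, hE, hP⟩ := h.hopf
  have hn3 : (3 : ℝ) ≤ n := by exact_mod_cast h.hn
  have hT : ∀ s ∈ Ioo (k : ℝ) (k + n), ((k : ℝ), s) ∈ TT n := fun s hs => ⟨hs.1, hs.2⟩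
  obtain ⟨m, hm⟩ := sin_range (S := Ioo (k : ℝ) (k + n)) (f := fun s => c (k, s))
    isPreconnected_Ioo (hc.comp (by fun_prop) hT) (by
      intro s hs
      have h1 := hA _ (hT s hs)
      have h2 := cr_ang h1 0
      have h3 := norm_pos_iff.2 (h.chord_ne (hT s hs))
      have h4 : cr 0 (pp V r θ s - pp V r θ k) = (pp V r θ s).im - (V k).im := by
        rw [h.pp_int]; simp [cr, cis_zero]
      simp only at h2 h3
      rw [h4, sub_zero] at h2
      have h5 := hk s
      have h6 : 0 ≤ ‖pp V r θ s - pp V r θ k‖ * Real.sin (c (k, s)) := by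
        rw [← h2]; linarith
      exact nonneg_of_mul_nonneg_right h6 h3)
    (x0 := k + 1) ⟨by linarith, by linarith⟩
  refine ⟨k, m, hk, ?_, ?_⟩
  · have h1 := (hm (k - 1 + n) ⟨by linarith, by linarith⟩).2
    have e1 : ((k : ℝ) - 1, (k : ℝ)) ∈ EE (k - 1) := ⟨by simp, by simp, by simp⟩
    have h2 := hP _ (h.EE_sub _ e1)
    have h3 := hE _ _ e1
    simp only at h2 h1
    rw [h2, h3] at h1
    linarith
  · have h1 := (hm (k + 1) ⟨by linarith, by linarith⟩).1
    have e1 : ((k : ℝ), (k : ℝ) + 1) ∈ EE k := ⟨by simp, by simp, by simp⟩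
    have h3 := hE _ _ e1
    rwa [h3] at h1

end PC
end MS

namespace MS

lemma inter_frontier_ne {X : Type*} [TopologicalSpace X] {G K : Set X} (hG : IsPreconnected G)
    (h1 : (G ∩ K).Nonempty) (h2 : (G ∩ Kᶜ).Nonempty) : (G ∩ frontier K).Nonempty := by
  by_contra hcon
  have hno : ∀ y ∈ G, y ∉ frontier K := fun y hy hyf => hcon ⟨y, hy, hyf⟩
  obtain ⟨a, ha, haK⟩ := h1
  obtain ⟨b, hb, hbK⟩ := h2
  have hcov : G ⊆ interior K ∪ (closure K)ᶜ := by
    intro y hy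
    by_cases hyi : y ∈ interior K
    · exact Or.inl hyi
    · exact Or.inr fun hyc => hno y hy ⟨hyc, hyi⟩
  obtain ⟨y, -, hy1, hy2⟩ := hG (interior K) (closure K)ᶜ isOpen_interior
    isClosed_closure.isOpen_compl hcov
    ⟨a, ha, (hcov ha).resolve_right fun h => h (subset_closure haK)⟩
    ⟨b, hb, (hcov hb).resolve_left fun h => hbK (interior_subset h)⟩
  exact hy2 (subset_closure (interior_subset hy1))

lemma norm_real_cis (c t : ℝ) : ‖(c : ℂ) * cis t‖ = |c| := by
  rw [norm_mul, norm_cis, Complex.norm_real, Real.norm_eq_abs, mul_one]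

lemma rs_right {α β c : ℝ} (h : |β - α| < π) (hc : 0 < c) : ∃ δ0 > (0 : ℝ), ∀ δ : ℝ, 0 < δ → δ < δ0 →
    RS α β (c * cis β - δ * (Complex.I * cis β)) := by
  rcases le_or_gt α β with hab | hab
  · refine ⟨1, one_pos, fun δ hδ _ => Or.inl ⟨hab, Or.inr ?_⟩⟩
    rw [cr_sub, cr_smul, cr_smul, cr_cis, cr_I_cis]; simpa using hδ
  · have h' : |α - β| < π := by rwa [abs_sub_comm]
    have h1 := sin_pos_of h' hab
    have h6 : Real.sin (β - α) = - Real.sin (α - β) := by rw [← Real.sin_neg]; ring_nf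
    refine ⟨c * Real.sin (α - β), by positivity, fun δ hδ h2 => Or.inr ⟨hab, ?_, ?_⟩⟩
    · rw [cr_sub, cr_smul, cr_smul, cr_cis, cr_I_cis, h6]
      nlinarith [Real.neg_one_le_cos (β - α)]
    · rw [cr_sub, cr_smul, cr_smul, cr_cis, cr_I_cis]; simpa using hδ

lemma rs_left {α β c : ℝ} (h : |β - α| < π) (hc : 0 < c) : ∃ δ0 > (0 : ℝ), ∀ δ : ℝ, 0 < δ → δ < δ0 →
    RS α β (-(c * cis α) - δ * (Complex.I * cis α)) := by
  rcases le_or_gt α β with hab | hab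
  · refine ⟨1, one_pos, fun δ hδ _ => Or.inl ⟨hab, Or.inl ?_⟩⟩
    rw [cr_sub, cr_neg, cr_smul, cr_smul, cr_cis, cr_I_cis]; simpa using hδ
  · have h' : |α - β| < π := by rwa [abs_sub_comm]
    have h1 := sin_pos_of h' hab
    refine ⟨c * Real.sin (α - β), by positivity, fun δ hδ h2 => Or.inr ⟨hab, ?_, ?_⟩⟩
    · rw [cr_sub, cr_neg, cr_smul, cr_smul, cr_cis, cr_I_cis]; simpa using hδ
    · rw [cr_sub, cr_neg, cr_smul, cr_smul, cr_cis, cr_I_cis]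
      nlinarith [Real.neg_one_le_cos (α - β)]

lemma rs_nv {α β δ : ℝ} (h : |β - α| < π) (hδ : 0 < δ) : RS α β (-(δ * nv α β)) := by
  have hp := cos_add_pos h
  have h1 : cr α (-(δ * nv α β)) < 0 := by rw [cr_neg, cr_smul, cr_nv_left]; nlinarith
  have h2 : cr β (-(δ * nv α β)) < 0 := by rw [cr_neg, cr_smul, cr_nv_right]; nlinarith
  rcases le_or_gt α β with hab | hab
  · exact Or.inl ⟨hab, Or.inl h1⟩
  · exact Or.inr ⟨hab, h1, h2⟩

variable {K : Set ℂ} {n : ℕ} {V : ℤ → ℂ} {r θ : ℤ → ℝ}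

namespace PC

lemma germ (h : PC K n V r θ) (s : ℝ) : ∃ ρ > 0, ∀ w : ℂ, ‖w‖ < ρ →
    (pp V r θ s + w ∈ frontier K ↔ Ry (θ (⌈s⌉ - 1)) (θ ⌊s⌋) w) := by
  rw [h.fr]; exact h.loc s

lemma common (h : PC K n V r θ) (s ρ : ℝ) (hρ : 0 < ρ) : ∃ ε > 0, ∀ s', |s' - s| < ε →
    ∀ ρ' > 0, ∃ w w' : ℂ, ‖w‖ < ρ ∧ RS (θ (⌈s⌉ - 1)) (θ ⌊s⌋) w ∧
      ‖w'‖ < ρ' ∧ RS (θ (⌈s'⌉ - 1)) (θ ⌊s'⌋) w' ∧ pp V r θ s + w = pp V r θ s' + w' := by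
  obtain ⟨ε, hε, -, h1, h2⟩ := loc_eps s
  have hr1 := h.rpos ⌊s⌋
  have hr2 := h.rpos (⌈s⌉ - 1)
  refine ⟨min ε (min (ρ / 2 / r ⌊s⌋) (ρ / 2 / r (⌈s⌉ - 1))), by positivity, ?_⟩
  intro s' hs' ρ' hρ'
  simp only [lt_min_iff] at hs'
  obtain ⟨ha, hb, hc⟩ := hs'
  rw [lt_div_iff₀ hr1] at hb
  rw [lt_div_iff₀ hr2] at hc
  rw [abs_lt] at ha
  have ht := h.turn' s
  rcases lt_trichotomy s s' with hlt | rfl | hlt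
  · have f1 : ⌊s'⌋ = ⌊s⌋ := Int.floor_eq_iff.2 ⟨by linarith [Int.floor_le s], by linarith⟩
    have f2 : ⌈s'⌉ = ⌊s⌋ + 1 := Int.ceil_eq_iff.2 ⟨by push_cast; linarith [Int.floor_le s],
      by push_cast; linarith⟩
    set c := (s' - s) * r ⌊s⌋ with hcdef
    have hc0 : 0 < c := mul_pos (by linarith) hr1
    rw [abs_of_pos (by linarith)] at hb
    obtain ⟨δ0, hδ0, hd⟩ := rs_right ht hc0
    obtain ⟨δ, hδ1, hδ2⟩ := exists_between (show 0 < min δ0 (min ρ' (ρ / 2)) by positivity)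
    simp only [lt_min_iff] at hδ2
    refine ⟨c * cis (θ ⌊s⌋) - δ * (Complex.I * cis (θ ⌊s⌋)), -(δ * (Complex.I * cis (θ ⌊s⌋))),
      ?_, hd δ hδ1 hδ2.1, ?_, ?_, ?_⟩
    · refine (norm_sub_le _ _).trans_lt ?_
      rw [norm_real_cis, norm_mul, norm_mul, norm_cis, Complex.norm_real, Real.norm_eq_abs,
        abs_of_pos hδ1, abs_of_pos hc0, Complex.norm_I]
      linarith
    · rw [norm_neg, norm_mul, norm_mul, norm_cis, Complex.norm_real, Real.norm_eq_abs,
        abs_of_pos hδ1, Complex.norm_I]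
      linarith
    · rw [f1, f2, add_sub_cancel_right]
      exact rs_normal (by simp [Real.pi_pos]) le_rfl le_rfl hδ1
    · rw [h.pp_right hlt.le (by linarith), hcdef]; push_cast; ring
  · obtain ⟨δ, hδ1, hδ2⟩ := exists_between (show 0 < min (ρ' / 2) (ρ / 2) by positivity)
    simp only [lt_min_iff] at hδ2
    refine ⟨-(δ * nv _ _), -(δ * nv _ _), ?_, rs_nv ht hδ1, ?_, rs_nv ht hδ1, rfl⟩
    · rw [norm_neg]; exact small_nv _ _ hδ1 hδ2.2
    · rw [norm_neg]; exact small_nv _ _ hδ1 hδ2.1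
  · have f1 : ⌊s'⌋ = ⌈s⌉ - 1 := Int.floor_eq_iff.2 ⟨by linarith,
      by have := Int.le_ceil s; push_cast; linarith⟩
    have f2 : ⌈s'⌉ = ⌈s⌉ := Int.ceil_eq_iff.2 ⟨by push_cast at h2; linarith,
      by have := Int.le_ceil s; linarith⟩
    set c := (s - s') * r (⌈s⌉ - 1) with hcdef
    have hc0 : 0 < c := mul_pos (by linarith) hr2
    rw [abs_of_neg (by linarith)] at hc
    obtain ⟨δ0, hδ0, hd⟩ := rs_left ht hc0
    obtain ⟨δ, hδ1, hδ2⟩ := exists_between (show 0 < min δ0 (min ρ' (ρ / 2)) by positivity)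
    simp only [lt_min_iff] at hδ2
    refine ⟨-(c * cis (θ (⌈s⌉ - 1))) - δ * (Complex.I * cis (θ (⌈s⌉ - 1))),
      -(δ * (Complex.I * cis (θ (⌈s⌉ - 1)))),
      ?_, hd δ hδ1 hδ2.1, ?_, ?_, ?_⟩
    · refine (norm_sub_le _ _).trans_lt ?_
      rw [norm_neg, norm_real_cis, norm_mul, norm_mul, norm_cis, Complex.norm_real,
        Real.norm_eq_abs, abs_of_pos hδ1, abs_of_pos hc0, Complex.norm_I]
      linarith
    · rw [norm_neg, norm_mul, norm_mul, norm_cis, Complex.norm_real, Real.norm_eq_abs,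
        abs_of_pos hδ1, Complex.norm_I]
      linarith
    · rw [f1, f2]
      exact rs_normal (by simp [Real.pi_pos]) le_rfl le_rfl hδ1
    · rw [h.pp_left hlt.le (by linarith), hcdef]; push_cast; ring

lemma frontier_mem (h : PC K n V r θ) (s : ℝ) : pp V r θ s ∈ frontier K := by
  rw [h.fr]; exact mem_range_self s

lemma curve_mem (h : PC K n V r θ) (s : ℝ) : pp V r θ s ∈ K :=
  h.compact.isClosed.frontier_subset (h.frontier_mem s)

lemma half_compl (h : PC K n V r θ) {k : ℤ} (hk : ∀ s, (V k).im ≤ (pp V r θ s).im) :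
    ∀ z : ℂ, z.im < (V k).im → z ∉ K := by
  intro z hz hzK
  obtain ⟨y, hy, hmin⟩ := h.compact.exists_isMinOn ⟨z, hzK⟩ Complex.continuous_im.continuousOn
  have h1 : y.im ≤ z.im := hmin hzK
  have h2 : y ∉ interior K := by
    intro hyi
    obtain ⟨ε, hε, hb⟩ := Metric.isOpen_iff.1 isOpen_interior y hyi
    have h3 : y - ((ε / 2 : ℝ) : ℂ) * Complex.I ∈ K := by
      refine interior_subset (hb ?_)
      rw [Metric.mem_ball, dist_eq_norm]
      simp [abs_of_pos hε]; linarith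
    have h4 : y.im ≤ (y - ((ε / 2 : ℝ) : ℂ) * Complex.I).im := hmin h3
    simp at h4
    linarith
  have h3 : y ∈ frontier K := ⟨subset_closure hy, h2⟩
  rw [h.fr] at h3
  obtain ⟨s, rfl⟩ := h3
  linarith [hk s]

/-- All right germs lie in one component of the complement. -/
lemma right_germs (h : PC K n V r θ) : ∃ z0 ∉ K, ∀ s, ∃ ρ > 0, ∀ w : ℂ, ‖w‖ < ρ →
    RS (θ (⌈s⌉ - 1)) (θ ⌊s⌋) w → pp V r θ s + w ∈ connectedComponentIn Kᶜ z0 := by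
  obtain ⟨k, m, hk, hm1, hm2⟩ := h.bottom
  have hhalf := h.half_compl hk
  refine ⟨V k - Complex.I, hhalf _ (by simp), ?_⟩
  set C0 := connectedComponentIn Kᶜ (V k - Complex.I) with hC0
  choose ρ hρ hg using h.germ
  have A : ∀ s w, ‖w‖ < ρ s → RS (θ (⌈s⌉ - 1)) (θ ⌊s⌋) w → pp V r θ s + w ∈ C0 →
      ∀ w', ‖w'‖ < ρ s → RS (θ (⌈s⌉ - 1)) (θ ⌊s⌋) w' → pp V r θ s + w' ∈ C0 := by
    intro s w hw1 hw2 hw3 w' hw1' hw2'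
    set G := (fun w => pp V r θ s + w) '' {w | ‖w‖ < ρ s ∧ RS (θ (⌈s⌉ - 1)) (θ ⌊s⌋) w} with hG
    have hGp : IsPreconnected G := (rs_preconn (h.turn' s) (hρ s)).image _
      (by fun_prop)
    have hGf : ¬ (G ∩ frontier K).Nonempty := by
      rintro ⟨_, ⟨v, hv, rfl⟩, hv'⟩
      exact rs_not_ry (h.turn' s) hv.2 ((hg s v hv.1).1 hv')
    have hwG : pp V r θ s + w ∈ G := ⟨w, ⟨hw1, hw2⟩, rfl⟩
    have hwG' : pp V r θ s + w' ∈ G := ⟨w', ⟨hw1', hw2'⟩, rfl⟩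
    have hGK : G ⊆ Kᶜ := by
      intro y hy hyK
      exact hGf (inter_frontier_ne hGp ⟨y, hy, hyK⟩
        ⟨_, hwG, connectedComponentIn_subset _ _ hw3⟩)
    have := hGp.subset_connectedComponentIn hwG hGK hwG'
    rwa [← connectedComponentIn_eq hw3] at this
  let Good : ℝ → Prop := fun s => ∀ w, ‖w‖ < ρ s → RS (θ (⌈s⌉ - 1)) (θ ⌊s⌋) w →
    pp V r θ s + w ∈ C0
  have hloc : ∀ s, ∃ ε > 0, ∀ s', |s' - s| < ε → (Good s ↔ Good s') := by
    intro s
    obtain ⟨ε, hε, hc⟩ := h.common s (ρ s) (hρ s)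
    refine ⟨ε, hε, fun s' hs' => ?_⟩
    obtain ⟨w, w', h1, h2, h3, h4, h5⟩ := hc s' hs' (ρ s') (hρ s')
    constructor
    · intro hG
      refine A s' w' h3 h4 ?_
      rw [← h5]; exact hG w h1 h2
    · intro hG
      refine A s w h1 h2 ?_
      rw [h5]; exact hG w' h3 h4
  have hbase : Good k := by
    have hδ : 0 < ρ k / 2 := by linarith [hρ k]
    have hRS := rs_normal (h.turn' k) (γ := 2 * π * m) (by simpa using hm1) (by simpa using hm2) hδ
    refine A k _ ?_ hRS ?_
    · rw [norm_neg, norm_mul, norm_mul, norm_cis, Complex.norm_real, Real.norm_eq_abs,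
        abs_of_pos hδ, Complex.norm_I]
      linarith [hρ k]
    · have hconv : IsPreconnected {z : ℂ | z.im < (V k).im} :=
        (convex_halfSpace_im_lt (V k).im).isPreconnected
      refine hconv.subset_connectedComponentIn (x := V k - Complex.I) ?_ (fun z hz => hhalf z hz) ?_
      · simp
      · have : cis (2 * π * m) = 1 := by
          rw [cis]; rw [Complex.exp_eq_one_iff]; exact ⟨m, by push_cast; ring⟩
        rw [this, h.pp_int]
        simp [hρ k]
  have hclopen : IsClopen {s | Good s} := by
    refine ⟨⟨Metric.isOpen_iff.2 fun s hs => ?_⟩, Metric.isOpen_iff.2 fun s hs => ?_⟩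
    · obtain ⟨ε, hε, he⟩ := hloc s
      exact ⟨ε, hε, fun s' hs' hs'' => hs ((he s' hs').2 hs'')⟩
    · obtain ⟨ε, hε, he⟩ := hloc s
      exact ⟨ε, hε, fun s' hs' => (he s' hs').1 hs⟩
  have huniv := hclopen.eq_univ ⟨_, hbase⟩
  intro s
  have : s ∈ {s | Good s} := by rw [huniv]; trivial
  exact ⟨ρ s, hρ s, this⟩

lemma left_germs (h : PC K n V r θ) (s : ℝ) : ∃ ρ > 0, ∀ w : ℂ, ‖w‖ < ρ →
    LS (θ (⌈s⌉ - 1)) (θ ⌊s⌋) w → pp V r θ s + w ∈ K := by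
  obtain ⟨z0, hz0, hR⟩ := h.right_germs
  obtain ⟨ρ1, hρ1, hr⟩ := hR s
  obtain ⟨ρ2, hρ2, hg⟩ := h.germ s
  set ρ := min ρ1 ρ2
  have hρ : 0 < ρ := lt_min hρ1 hρ2
  refine ⟨ρ, hρ, ?_⟩
  have h1 : pp V r θ s ∈ closure (interior K) := by
    rw [← h.regular]; exact h.curve_mem s
  obtain ⟨y, hyK, hy⟩ := Metric.mem_closure_iff.1 h1 ρ hρ
  obtain ⟨w, rfl⟩ : ∃ w, y = pp V r θ s + w := ⟨y - pp V r θ s, by ring⟩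
  rw [dist_comm, dist_eq_norm, add_sub_cancel_left] at hy
  have hw : LS (θ (⌈s⌉ - 1)) (θ ⌊s⌋) w := by
    rcases tri (h.turn' s) w with h2 | h2 | h2
    · exfalso
      exact connectedComponentIn_subset _ _ (hr w (hy.trans_le (min_le_left _ _)) h2)
        (interior_subset hyK)
    · exact h2
    · exfalso
      exact ((hg w (hy.trans_le (min_le_right _ _))).2 h2).2 hyK
  set G := (fun w => pp V r θ s + w) '' {w | ‖w‖ < ρ ∧ LS (θ (⌈s⌉ - 1)) (θ ⌊s⌋) w} with hG
  have hGp : IsPreconnected G := (ls_preconn (h.turn' s) hρ).image _ (by fun_prop)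
  have hGf : ¬ (G ∩ frontier K).Nonempty := by
    rintro ⟨_, ⟨v, hv, rfl⟩, hv'⟩
    exact ls_not_ry (h.turn' s) hv.2 ((hg v (hv.1.trans_le (min_le_right _ _))).1 hv')
  intro w' hw1 hw2
  by_contra hcon
  exact hGf (inter_frontier_ne hGp ⟨_, ⟨w, ⟨hy, hw⟩, rfl⟩, interior_subset hyK⟩
    ⟨_, ⟨w', ⟨hw1, hw2⟩, rfl⟩, hcon⟩)

lemma compl_preconn (h : PC K n V r θ) : IsPreconnected Kᶜ := by
  obtain ⟨z0, hz0, hR⟩ := h.right_germs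
  have hopen : IsOpen Kᶜ := h.compact.isClosed.isOpen_compl
  have : Kᶜ = connectedComponentIn Kᶜ z0 := by
    refine subset_antisymm ?_ (connectedComponentIn_subset _ _)
    intro y hy
    set W := connectedComponentIn Kᶜ y with hW
    have hWo : IsOpen W := hopen.connectedComponentIn
    have hyW : y ∈ W := mem_connectedComponentIn hy
    have hfr : (frontier W).Nonempty := by
      rw [nonempty_iff_ne_empty]
      intro hemp
      have hcl : IsClopen W := isClopen_iff_frontier_eq_empty.2 hemp
      have hu := hcl.eq_univ ⟨y, hyW⟩
      have h1 : pp V r θ 0 ∈ W := by rw [hu]; trivial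
      exact connectedComponentIn_subset _ _ h1 (h.curve_mem 0)
    obtain ⟨z, hz⟩ := hfr
    have hzW : z ∉ W := by
      have := hz.2
      rwa [hWo.interior_eq] at this
    have hzK : z ∈ K := by
      by_contra hcon
      have h1 : z ∈ connectedComponentIn Kᶜ z := mem_connectedComponentIn hcon
      obtain ⟨v, hv1, hv2⟩ := mem_closure_iff.1 hz.1 _ hopen.connectedComponentIn h1
      have e1 := connectedComponentIn_eq hv1
      have e2 := connectedComponentIn_eq hv2
      rw [e1, ← e2] at h1
      exact hzW h1
    have hzf : z ∈ frontier K := by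
      rw [frontier_eq_closure_inter_closure]
      exact ⟨subset_closure hzK, closure_mono (connectedComponentIn_subset _ _) hz.1⟩
    rw [h.fr] at hzf
    obtain ⟨s, rfl⟩ := hzf
    obtain ⟨ρ1, hρ1, hr⟩ := hR s
    obtain ⟨ρ2, hρ2, hg⟩ := h.germ s
    obtain ⟨ρ3, hρ3, hl⟩ := h.left_germs s
    obtain ⟨q, hqW, hq⟩ := Metric.mem_closure_iff.1 hz.1 (min ρ1 (min ρ2 ρ3)) (by positivity)
    obtain ⟨w, rfl⟩ : ∃ w, q = pp V r θ s + w := ⟨q - pp V r θ s, by ring⟩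
    rw [dist_comm, dist_eq_norm, add_sub_cancel_left] at hq
    simp only [lt_min_iff] at hq
    have hqK := connectedComponentIn_subset _ _ hqW
    rcases tri (h.turn' s) w with h2 | h2 | h2
    · have e1 := connectedComponentIn_eq hqW
      have e2 := connectedComponentIn_eq (hr w hq.1 h2)
      rw [e2, ← e1]; exact hyW
    · exact absurd (hl w hq.2.2 h2) hqK
    · exact absurd (h.compact.isClosed.frontier_subset ((hg w hq.2.1).2 h2)) hqK
  rw [this]; exact isPreconnected_connectedComponentIn

end PC
end MS

namespace MS

lemma slit_one_sub {z : ℂ} (hz : ‖z‖ < 1) : 1 - z ∈ Complex.slitPlane := by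
  left
  have := (Complex.abs_re_le_norm z).trans_lt hz
  rw [abs_lt] at this
  simp; linarith

/-- `p - y` has a continuous argument on `K`. -/
def HasLift (K : Set ℂ) (y : ℂ) : Prop :=
  ∃ B : ℂ → ℝ, ContinuousOn B K ∧ ∀ p ∈ K, Ang (p - y) (B p)

lemma HasLift.move {K : Set ℂ} {y d : ℂ} (h : HasLift K y) (hd : ∀ p ∈ K, ‖d‖ < ‖p - y‖) :
    HasLift K (y + d) := by
  obtain ⟨B, hB, hA⟩ := h
  have hne : ∀ p ∈ K, p - y ≠ 0 := fun p hp h0 => by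
    have := hd p hp
    rw [h0, norm_zero] at this
    exact absurd this (not_lt.2 (norm_nonneg _))
  refine ⟨fun p => B p + Complex.arg (1 - d / (p - y)), ?_, ?_⟩
  · refine hB.add ?_
    intro p hp
    have h1 : 1 - d / (p - y) ∈ Complex.slitPlane := by
      apply slit_one_sub
      rw [norm_div, div_lt_one (norm_pos_iff.2 (hne p hp))]
      exact hd p hp
    have h2 : ContinuousAt (fun p : ℂ => 1 - d / (p - y)) p :=
      continuousAt_const.sub (continuousAt_const.div (by fun_prop) (hne p hp))
    exact (ContinuousAt.comp (f := fun p : ℂ => 1 - d / (p - y))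
      (Complex.continuousAt_arg h1) h2).continuousWithinAt
  · intro p hp
    have e : p - (y + d) = (p - y) * (1 - d / (p - y)) := by
      have := hne p hp
      field_simp; ring
    rw [e]
    exact ang_mul (hA p hp) (ang_arg _)

lemma hasLift_far {K : Set ℂ} {y : ℂ} (hy : y ≠ 0) (h : ∀ p ∈ K, ‖p‖ < ‖y‖) : HasLift K y := by
  refine ⟨fun p => Complex.arg (-y) + Complex.arg (1 - p / y), ?_, ?_⟩
  · refine continuousOn_const.add ?_
    intro p hp
    have h1 : 1 - p / y ∈ Complex.slitPlane := by
      apply slit_one_sub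
      rw [norm_div, div_lt_one (norm_pos_iff.2 hy)]
      exact h p hp
    have h2 : ContinuousAt (fun p : ℂ => 1 - p / y) p := by fun_prop
    exact (ContinuousAt.comp (f := fun p : ℂ => 1 - p / y)
      (Complex.continuousAt_arg h1) h2).continuousWithinAt
  · intro p hp
    have e : p - y = (-y) * (1 - p / y) := by field_simp; ring
    rw [e]
    exact ang_mul (ang_arg _) (ang_arg _)

lemma hasLift_all {K : Set ℂ} (hK : IsCompact K) (hc : IsPreconnected Kᶜ) {y : ℂ} (hy : y ∉ K) :
    HasLift K y := by
  by_contra hcon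
  have hloc : ∀ z ∉ K, ∃ ε > 0, ∀ z', dist z' z < ε → (HasLift K z ↔ HasLift K z') ∧ z' ∉ K := by
    intro z hz
    obtain ⟨ε, hε, hb⟩ := Metric.isOpen_iff.1 hK.isClosed.isOpen_compl z hz
    have hfar : ∀ p ∈ K, ε ≤ ‖p - z‖ := by
      intro p hp
      by_contra h
      exact hb (by rw [Metric.mem_ball, dist_eq_norm]; linarith) hp
    refine ⟨ε / 2, by linarith, fun z' hz' => ?_⟩
    rw [dist_eq_norm] at hz'
    refine ⟨⟨fun hl => ?_, fun hl => ?_⟩, ?_⟩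
    · have := hl.move (d := z' - z) (fun p hp => by have := hfar p hp; linarith)
      simpa using this
    · have := hl.move (d := z - z') (fun p hp => by
        have h1 := hfar p hp
        have h2 : ‖p - z‖ ≤ ‖p - z'‖ + ‖z' - z‖ := by
          have := norm_add_le (p - z') (z' - z)
          simpa using this
        rw [norm_sub_rev]; linarith)
      simpa using this
    · intro hK'
      have := hfar z' hK'
      linarith
  obtain ⟨R, hR⟩ := hK.isBounded.exists_norm_le
  obtain ⟨q, hq, hq1, hq2⟩ := hc {z | z ∉ K ∧ HasLift K z} {z | z ∉ K ∧ ¬ HasLift K z}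
    (Metric.isOpen_iff.2 fun z hz => by
      obtain ⟨ε, hε, he⟩ := hloc z hz.1
      exact ⟨ε, hε, fun z' hz' => ⟨(he z' hz').2, (he z' hz').1.1 hz.2⟩⟩)
    (Metric.isOpen_iff.2 fun z hz => by
      obtain ⟨ε, hε, he⟩ := hloc z hz.1
      exact ⟨ε, hε, fun z' hz' => ⟨(he z' hz').2, fun h => hz.2 ((he z' hz').1.2 h)⟩⟩)
    (fun z hz => by
      by_cases h : HasLift K z
      · exact Or.inl ⟨hz, h⟩
      · exact Or.inr ⟨hz, h⟩)
    (by
      have hn : ‖((|R| + 1 : ℝ) : ℂ)‖ = |R| + 1 := by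
        rw [Complex.norm_real, Real.norm_eq_abs, abs_of_pos (by positivity)]
      have hlt : ∀ p ∈ K, ‖p‖ < ‖((|R| + 1 : ℝ) : ℂ)‖ := by
        intro p hp
        rw [hn]
        linarith [hR p hp, le_abs_self R]
      have hnK : ((|R| + 1 : ℝ) : ℂ) ∉ K := fun h => lt_irrefl _ (hlt _ h)
      exact ⟨_, hnK, hnK, hasLift_far (by
        rw [← norm_pos_iff, hn]; positivity) hlt⟩)
    ⟨y, hy, hy, hcon⟩
  exact hq2.2 hq1.2

end MS

namespace MS

lemma sin_add_int (y : ℝ) (m : ℤ) : Real.sin (y - 2 * π * m) = Real.sin y := by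
  rw [show y - 2 * π * m = y - m * (2 * π) by ring]; exact Real.sin_sub_int_mul_two_pi y m

lemma cis_add_int (y : ℝ) (m : ℤ) : cis (y + 2 * π * m) = cis y := by
  rw [← cis_mul]
  have : cis (2 * π * m) = 1 := by
    rw [cis, Complex.exp_eq_one_iff]; exact ⟨m, by push_cast; ring⟩
  rw [this, mul_one]

lemma sincase {α β' β : ℝ} (h : |β' - α| < π) (h1 : Real.sin (β' - β) ≤ 0)
    (h2 : 0 ≤ Real.sin (α - β)) :
    ∃ m : ℤ, (α ≤ β + π + 2 * π * m ∧ β + π + 2 * π * m ≤ β') ∨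
      (β' ≤ β + 2 * π * m ∧ β + 2 * π * m ≤ α) := by
  have hpi := Real.pi_pos
  rw [abs_lt] at h
  set m := ⌊(α - β) / (2 * π)⌋ with hm
  have e1 : 2 * π * m ≤ α - β := by
    have := Int.floor_le ((α - β) / (2 * π))
    rw [le_div_iff₀ (by positivity)] at this
    linarith
  have e2 : α - β < 2 * π * m + 2 * π := by
    have := Int.lt_floor_add_one ((α - β) / (2 * π))
    rw [div_lt_iff₀ (by positivity)] at this
    rw [← hm] at this
    linarith
  have e3 : α - β ≤ 2 * π * m + π := by
    by_contra hcon
    have := Real.sin_neg_of_neg_of_neg_pi_lt (x := α - β - 2 * π * (m + 1 : ℤ))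
      (by push_cast; linarith) (by push_cast; linarith)
    rw [sin_add_int] at this
    linarith
  refine ⟨m, ?_⟩
  by_cases e4 : β' - β ≤ 2 * π * m
  · right; constructor <;> linarith
  · left
    push Not at e4
    have e5 : 2 * π * m + π ≤ β' - β := by
      by_contra hcon
      have := Real.sin_pos_of_pos_of_lt_pi (x := β' - β - 2 * π * m) (by linarith) (by linarith)
      rw [sin_add_int] at this
      linarith
    constructor <;> linarith

lemma lift_move {K : Set ℂ} {y z : ℂ} {B : ℂ → ℝ} (hB : ContinuousOn B K)
    (hA : ∀ p ∈ K, Ang (p - y) (B p)) (hz : z ∈ K) (hzy : z ≠ y) :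
    ∃ δ0 > (0 : ℝ), ∀ δ : ℝ, |δ| < δ0 → z + δ * (Complex.I * cis (B z)) ∈ K →
      (0 < δ → B z < B (z + δ * (Complex.I * cis (B z)))) ∧
      (δ < 0 → B (z + δ * (Complex.I * cis (B z))) < B z) := by
  have hpi := Real.pi_pos
  set R := ‖z - y‖ with hR
  have hRpos : 0 < R := norm_pos_iff.2 (sub_ne_zero.2 hzy)
  obtain ⟨δ1, hδ1, hc1⟩ := Metric.continuousOn_iff.1 hB z hz π hpi
  have hcont : ContinuousAt (fun δ : ℝ => Complex.arg (R + δ * Complex.I)) 0 := by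
    have h1 : ((R : ℂ) + (0 : ℝ) * Complex.I) ∈ Complex.slitPlane := by left; simpa using hRpos
    exact ContinuousAt.comp (f := fun δ : ℝ => ((R : ℂ) + δ * Complex.I)) (g := Complex.arg)
      (Complex.continuousAt_arg h1) (by fun_prop)
  obtain ⟨δ2, hδ2, hc2⟩ := Metric.continuousAt_iff.1 hcont π hpi
  refine ⟨min δ1 δ2, by positivity, ?_⟩
  intro δ hδ hK
  rw [lt_min_iff] at hδ
  set z' := z + δ * (Complex.I * cis (B z)) with hz'
  have d1 : dist z' z < δ1 := by
    rw [dist_eq_norm, hz', add_sub_cancel_left, norm_mul, norm_mul, norm_cis, Complex.norm_I,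
      Complex.norm_real, Real.norm_eq_abs]
    linarith [hδ.1]
  have b1 := hc1 z' hK d1
  have b2 := hc2 (x := δ) (by rw [dist_zero_right, Real.norm_eq_abs]; exact hδ.2)
  have a0 : Complex.arg ((R : ℂ) + (0 : ℝ) * Complex.I) = 0 := by
    simp [Complex.arg_ofReal_of_nonneg hRpos.le]
  rw [a0, Real.dist_eq, sub_zero] at b2
  rw [Real.dist_eq] at b1
  have e : z' - y = (R + δ * Complex.I) * cis (B z) := by
    have := hA z hz
    unfold Ang at this
    rw [hz', add_sub_right_comm, this, cis, hR]; ring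
  have hne : (R + δ * Complex.I : ℂ) ≠ 0 := by
    intro h0
    have := congrArg Complex.re h0
    simp at this
    exact hRpos.ne' this
  have hne' : z' - y ≠ 0 := by rw [e]; exact mul_ne_zero hne (cis_ne _)
  have hang : Ang (z' - y) (B z + Complex.arg (R + δ * Complex.I)) := by
    rw [e, mul_comm, ]
    have h1 : Ang (cis (B z)) (B z) := by
      have := ang_cis (r := 1) (φ := B z) zero_le_one
      simpa using this
    exact ang_mul h1 (ang_arg _)
  obtain ⟨m, hm⟩ := ang_unique hne' (hA z' hK) hang
  have hm0 : m = 0 := by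
    rw [abs_lt] at b1 b2
    have h1 : (m : ℝ) < 1 := by nlinarith
    have h2 : (-1 : ℝ) < m := by nlinarith
    have h3 : m < (1 : ℤ) := by exact_mod_cast h1
    have h4 : (-1 : ℤ) < m := by exact_mod_cast h2
    omega
  rw [hm0] at hm
  simp only [Int.cast_zero, mul_zero, add_zero] at hm
  have him : (R + δ * Complex.I : ℂ).im = δ := by simp
  constructor
  · intro h0
    have h1 : 0 ≤ Complex.arg (R + δ * Complex.I) := Complex.arg_nonneg_iff.2 (by rw [him]; exact h0.le)
    have h2 : Complex.arg (R + δ * Complex.I) ≠ 0 := by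
      intro h3
      have := Complex.arg_eq_zero_iff.1 h3
      rw [him] at this
      exact h0.ne' this.2
    have := lt_of_le_of_ne h1 (Ne.symm h2)
    linarith
  · intro h0
    have h1 : Complex.arg (R + δ * Complex.I) < 0 := Complex.arg_neg_iff.2 (by rw [him]; exact h0)
    linarith

variable {K : Set ℂ} {n : ℕ} {V : ℤ → ℂ} {r θ : ℤ → ℝ}

namespace PC

/-- The lift along the curve extends to `K`. -/
lemma curve_lift (h : PC K n V r θ) {y : ℂ} (hy : y ∉ K) {ψ : ℝ → ℝ} (hψ : Continuous ψ)
    (hA : ∀ s, Ang (pp V r θ s - y) (ψ s)) : ∃ B : ℂ → ℝ, ContinuousOn B K ∧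
    (∀ p ∈ K, Ang (p - y) (B p)) ∧ ∀ s, ψ s = B (pp V r θ s) := by
  obtain ⟨B, hB, hBA⟩ := hasLift_all h.compact h.compl_preconn hy
  have hne : ∀ s, pp V r θ s - y ≠ 0 := fun s h0 => hy (by
    rw [← sub_eq_zero.1 h0]; exact h.curve_mem s)
  have hcB : Continuous fun s => B (pp V r θ s) :=
    hB.comp_continuous h.continuous h.curve_mem
  have hv : ∀ s, ∃ m : ℤ, ψ s - B (pp V r θ s) = 0 + 2 * π * m := by
    intro s
    obtain ⟨m, hm⟩ := ang_unique (hne s) (hA s) (hBA _ (h.curve_mem s))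
    exact ⟨m, by rw [hm]; ring⟩
  obtain ⟨m, hm⟩ := hv 0
  refine ⟨fun p => B p + 2 * π * m, hB.add continuousOn_const, fun p hp => ang_shift (hBA p hp) m, ?_⟩
  intro s
  have := const_of_int (isPreconnected_univ) (f := fun s => ψ s - B (pp V r θ s))
    (hψ.sub hcB).continuousOn 0 (fun s _ => hv s) (mem_univ s) (mem_univ 0)
  rw [hm] at this
  linarith

lemma curve_per (h : PC K n V r θ) {y : ℂ} (hy : y ∉ K) {ψ : ℝ → ℝ} (hψ : Continuous ψ)
    (hA : ∀ s, Ang (pp V r θ s - y) (ψ s)) (s : ℝ) : ψ (s + n) = ψ s := by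
  obtain ⟨B, -, -, hB⟩ := h.curve_lift hy hψ hA
  rw [hB, hB, h.pper]

lemma bound_lift (h : PC K n V r θ) {y : ℂ} (hy : y ∉ K) {B : ℂ → ℝ} (hB : ContinuousOn B K)
    (hA : ∀ p ∈ K, Ang (p - y) (B p)) {b : ℝ} :
    ((∀ s, B (pp V r θ s) ≤ b) → ∀ p ∈ K, B p ≤ b) ∧
    ((∀ s, b ≤ B (pp V r θ s)) → ∀ p ∈ K, b ≤ B p) := by
  have hKne : K.Nonempty := ⟨_, h.curve_mem 0⟩
  have key : ∀ z ∈ K, z ∈ interior K → ∃ z1 ∈ K, ∃ z2 ∈ K, B z < B z1 ∧ B z2 < B z := by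
    intro z hz hzi
    have hzy : z ≠ y := fun h0 => hy (h0 ▸ hz)
    obtain ⟨δ0, hδ0, hd⟩ := lift_move hB hA hz hzy
    obtain ⟨ε, hε, hb⟩ := Metric.isOpen_iff.1 isOpen_interior z hzi
    obtain ⟨δ, h1, h2⟩ := exists_between (show 0 < min δ0 ε by positivity)
    rw [lt_min_iff] at h2
    have hin : ∀ δ' : ℝ, |δ'| < ε → z + δ' * (Complex.I * cis (B z)) ∈ K := by
      intro δ' hδ'
      refine interior_subset (hb ?_)
      rw [Metric.mem_ball, dist_eq_norm, add_sub_cancel_left, norm_mul, norm_mul, norm_cis,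
        Complex.norm_I, Complex.norm_real, Real.norm_eq_abs]
      linarith
    have i1 := hin δ (by rw [abs_of_pos h1]; exact h2.2)
    have i2 := hin (-δ) (by rw [abs_neg, abs_of_pos h1]; exact h2.2)
    exact ⟨_, i1, _, i2, (hd δ (by rw [abs_of_pos h1]; exact h2.1) i1).1 h1,
      (hd (-δ) (by rw [abs_neg, abs_of_pos h1]; exact h2.1) i2).2 (by linarith)⟩
  constructor
  · intro hb p hp
    obtain ⟨z, hz, hmax⟩ := h.compact.exists_isMaxOn hKne hB
    have hzf : z ∈ frontier K := by
      refine ⟨subset_closure hz, fun hzi => ?_⟩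
      obtain ⟨z1, hz1, -, -, hlt, -⟩ := key z hz hzi
      have := hmax hz1
      simp only [mem_ofPred_eq] at this
      linarith
    rw [h.fr] at hzf
    obtain ⟨s, rfl⟩ := hzf
    have : B p ≤ _ := hmax hp
    linarith [hb s]
  · intro hb p hp
    obtain ⟨z, hz, hmax⟩ := h.compact.exists_isMinOn hKne hB
    have hzf : z ∈ frontier K := by
      refine ⟨subset_closure hz, fun hzi => ?_⟩
      obtain ⟨-, -, z1, hz1, -, hlt⟩ := key z hz hzi
      have := hmax hz1
      simp only [mem_ofPred_eq] at this
      linarith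
    rw [h.fr] at hzf
    obtain ⟨s, rfl⟩ := hzf
    have : _ ≤ B p := hmax hp
    linarith [hb s]

lemma touch (h : PC K n V r θ) {s β : ℝ} (h1 : Real.sin (θ ⌊s⌋ - β) ≤ 0)
    (h2 : 0 ≤ Real.sin (θ (⌈s⌉ - 1) - β))
    (h3 : ∃ δ0 > (0 : ℝ), ∀ δ : ℝ, 0 < δ → δ < δ0 → pp V r θ s + δ * (Complex.I * cis β) ∉ K) :
    ∃ m : ℤ, θ (⌈s⌉ - 1) ≤ β + π + 2 * π * m ∧ β + π + 2 * π * m ≤ θ ⌊s⌋ := by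
  obtain ⟨m, hm | hm⟩ := sincase (h.turn' s) h1 h2
  · exact ⟨m, hm⟩
  · exfalso
    obtain ⟨δ0, hδ0, hd⟩ := h3
    obtain ⟨ρ, hρ, hl⟩ := h.left_germs s
    obtain ⟨δ, e1, e2⟩ := exists_between (show 0 < min δ0 ρ by positivity)
    rw [lt_min_iff] at e2
    have := ls_normal (h.turn' s) hm.1 hm.2 e1
    rw [cis_add_int] at this
    refine hd δ e1 e2.1 (hl _ ?_ this)
    rw [norm_mul, norm_mul, norm_cis, Complex.norm_I, Complex.norm_real, Real.norm_eq_abs,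
      abs_of_pos e1]
    linarith

lemma near (h : PC K n V r θ) (s : ℝ) {ψ : ℝ → ℝ} (hψ : Continuous ψ) : ∃ c > (0 : ℝ), ∃ s1 s2,
    |ψ s1 - ψ s| < π ∧ |ψ s2 - ψ s| < π ∧
    pp V r θ s1 = pp V r θ s + (c * r ⌊s⌋ : ℝ) * cis (θ ⌊s⌋) ∧
    pp V r θ s2 = pp V r θ s + (-(c * r (⌈s⌉ - 1)) : ℝ) * cis (θ (⌈s⌉ - 1)) := by
  obtain ⟨ε, hε, -, h1, h2⟩ := loc_eps s
  obtain ⟨δ, hδ, hd⟩ := Metric.continuous_iff.1 hψ s π Real.pi_pos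
  obtain ⟨c, e1, e2⟩ := exists_between (show 0 < min δ ε by positivity)
  rw [lt_min_iff] at e2
  refine ⟨c, e1, s + c, s - c, ?_, ?_, ?_, ?_⟩
  · have := hd (s + c) (by rw [Real.dist_eq, add_sub_cancel_left, abs_of_pos e1]; exact e2.1)
    rwa [Real.dist_eq] at this
  · have := hd (s - c) (by rw [Real.dist_eq, sub_sub_cancel_left, abs_neg, abs_of_pos e1]; exact e2.1)
    rwa [Real.dist_eq] at this
  · rw [h.pp_right (s := s) (by linarith) (by linarith)]; push_cast; ring
  · rw [h.pp_left (s := s) (by linarith) (by linarith)]; push_cast; ring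

lemma at_max (h : PC K n V r θ) {y : ℂ} (hy : y ∉ K) {ψ : ℝ → ℝ} (hψ : Continuous ψ)
    (hA : ∀ s, Ang (pp V r θ s - y) (ψ s)) {s1 : ℝ} (hmax : ∀ s, ψ s ≤ ψ s1) :
    ∃ m : ℤ, θ (⌈s1⌉ - 1) ≤ ψ s1 + π + 2 * π * m ∧ ψ s1 + π + 2 * π * m ≤ θ ⌊s1⌋ := by
  obtain ⟨B, hB, hBA, hBs⟩ := h.curve_lift hy hψ hA
  have hsgn : ∀ s, |ψ s - ψ s1| < π → cr (ψ s1) (pp V r θ s - y) ≤ 0 := by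
    intro s hs
    rw [cr_ang (hA s)]
    rw [abs_lt] at hs
    have := Real.sin_nonpos_of_nonpos_of_neg_pi_le (x := ψ s - ψ s1) (by linarith [hmax s])
      (by linarith)
    exact mul_nonpos_of_nonneg_of_nonpos (norm_nonneg _) this
  have h0 : cr (ψ s1) (pp V r θ s1 - y) = 0 := by rw [cr_ang (hA s1)]; simp
  obtain ⟨c, hc, u1, u2, g1, g2, e1, e2⟩ := h.near s1 hψ
  have hr1 := h.rpos ⌊s1⌋
  have hr2 := h.rpos (⌈s1⌉ - 1)
  have f1 := hsgn u1 g1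
  have f2 := hsgn u2 g2
  rw [e1, add_sub_right_comm, cr_add, h0, cr_smul, cr_cis, zero_add] at f1
  rw [e2, add_sub_right_comm, cr_add, h0, cr_smul, cr_cis, zero_add] at f2
  have hcr1 : 0 < c * r ⌊s1⌋ := by positivity
  have hcr2 : 0 < c * r (⌈s1⌉ - 1) := by positivity
  refine h.touch (by by_contra hcon; nlinarith) (by by_contra hcon; nlinarith) ?_
  have hzy : pp V r θ s1 ≠ y := fun h0 => hy (h0 ▸ h.curve_mem s1)
  obtain ⟨δ0, hδ0, hd⟩ := lift_move hB hBA (h.curve_mem s1) hzy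
  refine ⟨δ0, hδ0, fun δ hδ1 hδ2 hK => ?_⟩
  rw [hBs s1] at hK
  have h3 := (hd δ (by rwa [abs_of_pos hδ1]) hK).1 hδ1
  have h4 := (h.bound_lift hy hB hBA (b := ψ s1)).1 (fun s => by rw [← hBs]; exact hmax s) _ hK
  rw [hBs s1] at h4
  linarith

lemma at_min (h : PC K n V r θ) {y : ℂ} (hy : y ∉ K) {ψ : ℝ → ℝ} (hψ : Continuous ψ)
    (hA : ∀ s, Ang (pp V r θ s - y) (ψ s)) {s1 : ℝ} (hmin : ∀ s, ψ s1 ≤ ψ s) :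
    ∃ m : ℤ, θ (⌈s1⌉ - 1) ≤ ψ s1 + 2 * π * m ∧ ψ s1 + 2 * π * m ≤ θ ⌊s1⌋ := by
  obtain ⟨B, hB, hBA, hBs⟩ := h.curve_lift hy hψ hA
  have hsgn : ∀ s, |ψ s - ψ s1| < π → 0 ≤ cr (ψ s1) (pp V r θ s - y) := by
    intro s hs
    rw [cr_ang (hA s)]
    rw [abs_lt] at hs
    have := Real.sin_nonneg_of_nonneg_of_le_pi (x := ψ s - ψ s1) (by linarith [hmin s])
      (by linarith)
    exact mul_nonneg (norm_nonneg _) this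
  have h0 : cr (ψ s1) (pp V r θ s1 - y) = 0 := by rw [cr_ang (hA s1)]; simp
  obtain ⟨c, hc, u1, u2, g1, g2, e1, e2⟩ := h.near s1 hψ
  have hr1 := h.rpos ⌊s1⌋
  have hr2 := h.rpos (⌈s1⌉ - 1)
  have f1 := hsgn u1 g1
  have f2 := hsgn u2 g2
  rw [e1, add_sub_right_comm, cr_add, h0, cr_smul, cr_cis, zero_add] at f1
  rw [e2, add_sub_right_comm, cr_add, h0, cr_smul, cr_cis, zero_add] at f2
  have hcr1 : 0 < c * r ⌊s1⌋ := by positivity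
  have hcr2 : 0 < c * r (⌈s1⌉ - 1) := by positivity
  have hs : ∀ u : ℝ, Real.sin (u - (ψ s1 + π)) = - Real.sin (u - ψ s1) := by
    intro u
    rw [← sub_sub, Real.sin_sub_pi]
  have hcis : cis (ψ s1 + π) = - cis (ψ s1) := by
    rw [← cis_mul]
    have : cis π = -1 := by rw [cis]; exact Complex.exp_pi_mul_I
    rw [this]; ring
  obtain ⟨m, hm⟩ := h.touch (s := s1) (β := ψ s1 + π)
    (by rw [hs]; by_contra hcon; nlinarith) (by rw [hs]; by_contra hcon; nlinarith) (by
    have hzy : pp V r θ s1 ≠ y := fun h0 => hy (h0 ▸ h.curve_mem s1)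
    obtain ⟨δ0, hδ0, hd⟩ := lift_move hB hBA (h.curve_mem s1) hzy
    refine ⟨δ0, hδ0, fun δ hδ1 hδ2 hK => ?_⟩
    have e : pp V r θ s1 + δ * (Complex.I * cis (ψ s1 + π)) =
        pp V r θ s1 + ((-δ : ℝ) : ℂ) * (Complex.I * cis (B (pp V r θ s1))) := by
      rw [hcis, hBs s1]; push_cast; ring
    rw [e] at hK
    have h3 := (hd (-δ) (by rwa [abs_neg, abs_of_pos hδ1]) hK).2 (by linarith)
    have h4 := (h.bound_lift hy hB hBA (b := ψ s1)).2 (fun s => by rw [← hBs]; exact hmin s) _ hK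
    rw [hBs s1] at h4
    linarith)
  refine ⟨m + 1, ?_, ?_⟩ <;> push_cast <;> linarith [hm.1, hm.2]

end PC
end MS

namespace MS

/-- The combinatorial merging argument. -/
lemma merge {A B : ℕ → ℝ} {N N' : ℕ} {C : ℝ} {f : ℕ → ℕ → ℝ}
    (hA : ∀ i < N, A i < C) (hA2 : ∀ i i', i ≤ i' → i' < N → A i - π < A i')
    (hB : ∀ i < N', B i < C) (hB2 : ∀ i i', i ≤ i' → i' < N' → B i - π < B i')
    (stepA : ∀ i < N, ∀ j M, M - π < A i → A i ≤ M → f i j ≤ M → f (i + 1) j ≤ M)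
    (stepB : ∀ j < N', ∀ i M, M - π < B j → B j ≤ M → f i j ≤ M → f i (j + 1) ≤ M) :
    ∀ k i j M M', (N - i) + (N' - j) = k → i ≤ N → j ≤ N' → f i j < C →
      (i < N → A i ≤ M ∧ M < C ∧ f i j ≤ M ∧ ∀ i', i ≤ i' → i' < N → M - π < A i') →
      (j < N' → B j ≤ M' ∧ M' < C ∧ f i j ≤ M' ∧ ∀ j', j ≤ j' → j' < N' → M' - π < B j') →
      f N N' < C := by
  intro k
  induction k with
  | zero =>
    intro i j M M' hk hi hj hf _ _
    have h1 : i = N := by omega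
    have h2 : j = N' := by omega
    rwa [h1, h2] at hf
  | succ k ih =>
    intro i j M M' hk hi hj hf hM hM'
    have adv1 : ∀ hiN : i < N, (j < N' → M ≤ M') → f N N' < C := by
      intro hiN hle
      obtain ⟨a1, a2, a3, a4⟩ := hM hiN
      have hs := stepA i hiN j M (a4 i le_rfl hiN) a1 a3
      refine ih (i + 1) j (max M (A (i + 1))) M' (by omega) (by omega) hj (by linarith) ?_ ?_
      · intro h1
        refine ⟨le_max_right _ _, max_lt a2 (hA _ h1), hs.trans (le_max_left _ _), ?_⟩
        intro i' h2 h3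
        rw [sub_lt_iff_lt_add]
        refine max_lt ?_ ?_
        · linarith [a4 i' (by omega) h3]
        · linarith [hA2 (i + 1) i' h2 h3]
      · intro h1
        obtain ⟨b1, b2, b3, b4⟩ := hM' h1
        exact ⟨b1, b2, hs.trans (hle h1), b4⟩
    have adv2 : ∀ hjN : j < N', (i < N → M' ≤ M) → f N N' < C := by
      intro hjN hle
      obtain ⟨a1, a2, a3, a4⟩ := hM' hjN
      have hs := stepB j hjN i M' (a4 j le_rfl hjN) a1 a3
      refine ih i (j + 1) M (max M' (B (j + 1))) (by omega) hi (by omega) (by linarith) ?_ ?_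
      · intro h1
        obtain ⟨b1, b2, b3, b4⟩ := hM h1
        exact ⟨b1, b2, hs.trans (hle h1), b4⟩
      · intro h1
        refine ⟨le_max_right _ _, max_lt a2 (hB _ h1), hs.trans (le_max_left _ _), ?_⟩
        intro i' h2 h3
        rw [sub_lt_iff_lt_add]
        refine max_lt ?_ ?_
        · linarith [a4 i' (by omega) h3]
        · linarith [hB2 (j + 1) i' h2 h3]
    rcases lt_or_ge i N with hiN | hiN
    · rcases lt_or_ge j N' with hjN | hjN
      · rcases le_total M M' with h | h
        · exact adv1 hiN (fun _ => h)
        · exact adv2 hjN (fun _ => h)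
      · exact adv1 hiN (fun h => absurd h (not_lt.2 hjN))
    · exact adv2 (by omega) (fun h => absurd h (not_lt.2 hiN))

variable {K : Set ℂ} {n : ℕ} {V : ℤ → ℂ} {r θ : ℤ → ℝ}

namespace PC

lemma edge_step (h : PC K n V r θ) {y : ℂ} {ψ : ℝ → ℝ} (hψ : Continuous ψ)
    (hA : ∀ s, Ang (pp V r θ s - y) (ψ s)) (hne : ∀ s, pp V r θ s - y ≠ 0)
    {k : ℤ} {s s' : ℝ} (h1 : k ≤ s) (h2 : s ≤ s') (h3 : s' ≤ k + 1) {M : ℝ}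
    (hM1 : M - π < θ k) (hM2 : θ k ≤ M) (hs : ψ s + 4 * π ≤ M) : ψ s' + 4 * π ≤ M := by
  have hpi := Real.pi_pos
  by_contra hcon
  push Not at hcon
  set T := M - 4 * π with hT
  have hcomp : IsCompact (Icc s s' ∩ ψ ⁻¹' Iic T) :=
    isCompact_Icc.inter_right (isClosed_Iic.preimage hψ)
  obtain ⟨u, ⟨hu, huT⟩, humax⟩ := hcomp.exists_isGreatest
    ⟨s, ⟨le_rfl, h2⟩, by rw [mem_preimage, mem_Iic]; linarith⟩
  rw [mem_preimage, mem_Iic] at huT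
  have huT' : ψ u = T := by
    obtain ⟨v, hv, hvT⟩ := intermediate_value_Icc hu.2 hψ.continuousOn
      (show T ∈ Icc (ψ u) (ψ s') from ⟨huT, by linarith⟩)
    have : v ≤ u := humax ⟨⟨hu.1.trans hv.1, hv.2⟩, by rw [mem_preimage, mem_Iic]; exact hvT.le⟩
    have : v = u := le_antisymm this hv.1
    rw [← this, hvT]
  have hus' : u < s' := by
    rcases hu.2.lt_or_eq with h | h
    · exact h
    · rw [h] at huT; linarith
  obtain ⟨δ, hδ, hd⟩ := Metric.continuous_iff.1 hψ u π hpi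
  obtain ⟨v, hv1, hv2⟩ := exists_between (show u < min s' (u + δ) from lt_min hus' (by linarith))
  rw [lt_min_iff] at hv2
  have g1 : T < ψ v := by
    by_contra hc
    have : v ≤ u := humax ⟨⟨hu.1.trans hv1.le, hv2.1.le⟩, not_lt.1 hc⟩
    linarith
  have g2 : ψ v < T + π := by
    have := hd v (by rw [Real.dist_eq, abs_of_pos (by linarith)]; linarith [hv2.2])
    rw [Real.dist_eq, huT', abs_lt] at this
    linarith
  have e1 := cr_ang (hA v) T
  have e2 := cr_ang (hA u) T
  rw [huT', sub_self, Real.sin_zero, mul_zero] at e2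
  rw [h.pp_edge (k := k) (s := u) (by linarith [hu.1]) (by linarith) (by linarith [hu.1])
    (by linarith [hv2.1]), add_sub_right_comm, cr_add, e2, zero_add, cr_smul, cr_smul, cr_cis] at e1
  have e3 : 0 < Real.sin (ψ v - T) := Real.sin_pos_of_pos_of_lt_pi (by linarith) (by linarith)
  have e4 : Real.sin (θ k - T) ≤ 0 := by
    have := sin_add_int (θ k - T) 2
    rw [← this]
    refine Real.sin_nonpos_of_nonpos_of_neg_pi_le ?_ ?_ <;> push_cast <;> linarith
  have e5 := norm_pos_iff.2 (hne v)
  rw [h.pp_edge (k := k) (s := u) (by linarith [hu.1]) (by linarith) (by linarith [hu.1])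
    (by linarith [hv2.1]), add_sub_right_comm] at e5
  have e6 := mul_pos e5 e3
  rw [← e1] at e6
  have : (v - u) * (r k * Real.sin (θ k - T)) ≤ 0 :=
    mul_nonpos_of_nonneg_of_nonpos (by linarith)
      (mul_nonpos_of_nonneg_of_nonpos (h.rpos k).le e4)
  linarith

/-- Discretization of a parameter interval. -/
def uu (s e : ℝ) (k : ℕ) : ℝ := max s (min (⌊s⌋ + k) e)

lemma uu_zero (s e : ℝ) : uu s e 0 = s := by
  unfold uu
  have := Int.floor_le s
  rw [max_eq_left]
  exact (min_le_left _ _).trans (by simpa using this)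

lemma uu_end {s e : ℝ} (h : s ≤ e) : uu s e (⌈e⌉ - ⌊s⌋).toNat = e := by
  unfold uu
  have h1 : ⌊s⌋ ≤ ⌈e⌉ := by
    have : (⌊s⌋ : ℝ) ≤ ⌈e⌉ := (Int.floor_le s).trans (h.trans (Int.le_ceil e))
    exact_mod_cast this
  have h2 : ((⌈e⌉ - ⌊s⌋).toNat : ℝ) = ⌈e⌉ - ⌊s⌋ := by
    have : (((⌈e⌉ - ⌊s⌋).toNat : ℤ) : ℝ) = ((⌈e⌉ - ⌊s⌋ : ℤ) : ℝ) := by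
      rw [Int.toNat_of_nonneg (by omega)]
    push_cast at this
    exact this
  rw [h2, min_eq_right, max_eq_right h]
  linarith [Int.le_ceil e]

lemma uu_step {s e : ℝ} {k : ℕ} (hk : k < (⌈e⌉ - ⌊s⌋).toNat) :
    ((⌊s⌋ + k : ℤ) : ℝ) ≤ uu s e k ∧ uu s e k ≤ uu s e (k + 1) ∧
      uu s e (k + 1) ≤ ((⌊s⌋ + k : ℤ) : ℝ) + 1 := by
  unfold uu
  have h1 : ⌊s⌋ + k < ⌈e⌉ := by omega
  have h2 : ((⌊s⌋ + k : ℤ) : ℝ) < e := Int.lt_ceil.1 h1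
  push_cast at h2 ⊢
  refine ⟨?_, ?_, ?_⟩
  · rw [min_eq_left h2.le]; exact le_max_right _ _
  · exact max_le_max le_rfl (min_le_min (by linarith) le_rfl)
  · refine max_le ?_ ((min_le_left _ _).trans (by linarith))
    have := Int.lt_floor_add_one s
    have : (0 : ℝ) ≤ k := Nat.cast_nonneg k
    linarith

/-- The angle data along the arc from the minimum to the maximum. -/
lemma arc (h : PC K n V r θ) {s1 s0 a b : ℝ} (hab : a + 2 * π ≤ b)
    (h1 : ∃ m : ℤ, θ (⌈s1⌉ - 1) ≤ b + π + 2 * π * m ∧ b + π + 2 * π * m ≤ θ ⌊s1⌋)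
    (h0 : ∃ m : ℤ, θ (⌈s0⌉ - 1) ≤ a + 2 * π * m ∧ a + 2 * π * m ≤ θ ⌊s0⌋) :
    ∃ σ ε : ℝ, ∃ i j : ℤ, σ = s0 + i * n ∧ ε = s1 + j * n ∧ σ ≤ ε ∧ a + 4 * π ≤ θ ⌊σ⌋ ∧
      ∀ k < (⌈ε⌉ - ⌊σ⌋).toNat, θ (⌊σ⌋ + k) < b + 4 * π := by
  have hpi := Real.pi_pos
  have tp : ∀ (k m : ℤ), θ (k + m * n) = θ k + 2 * π * m := by
    intro k m
    induction m using Int.induction_on with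
    | zero => simp
    | succ i ih =>
      rw [show k + ((i : ℤ) + 1) * n = (k + i * n) + n by ring, h.tper, ih]; push_cast; ring
    | pred i ih =>
      have := h.tper (k + (-(i : ℤ) - 1) * n)
      rw [show k + (-(i : ℤ) - 1) * n + n = (k + -(i : ℤ) * n) by ring, ih] at this
      push_cast at this ⊢
      linarith
  have fl : ∀ (s : ℝ) (m : ℤ), ⌊s + m * n⌋ = ⌊s⌋ + m * n := by
    intro s m
    have := Int.floor_add_intCast s (m * n)
    push_cast at this; exact this
  have cl : ∀ (s : ℝ) (m : ℤ), ⌈s + m * n⌉ = ⌈s⌉ + m * n := by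
    intro s m
    have := Int.ceil_add_intCast s (m * n)
    push_cast at this; exact this
  obtain ⟨m1, a1, a2⟩ := h1
  obtain ⟨m0, b1, b2⟩ := h0
  set τ := s1 + ((-m1 : ℤ) : ℝ) * n with hτ
  have c1 : θ (⌈τ⌉ - 1) ≤ b + π := by
    rw [hτ, cl, show ⌈s1⌉ + -m1 * (n : ℤ) - 1 = (⌈s1⌉ - 1) + (-m1) * n by ring, tp]
    push_cast; linarith
  have c2 : b + π ≤ θ ⌊τ⌋ := by
    rw [hτ, fl, tp]; push_cast; linarith
  obtain ⟨i, hi, -⟩ := existsUnique_add_zsmul_mem_Ioc h.npos s0 τ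
  rw [zsmul_eq_mul] at hi
  refine ⟨s0 + i * n, τ + n, i, -m1 + 1, rfl, by rw [hτ]; push_cast; ring, hi.2, ?_, ?_⟩
  · have d1 : θ (⌈s0 + i * n⌉ - 1) ≤ a + 2 * π * (m0 + i) := by
      rw [cl, show ⌈s0⌉ + i * (n : ℤ) - 1 = (⌈s0⌉ - 1) + i * n by ring, tp]
      linarith
    have d2 : a + 2 * π * (m0 + i) ≤ θ ⌊s0 + i * n⌋ := by
      rw [fl, tp]; linarith
    have d3 : ⌊τ⌋ ≤ ⌈s0 + i * n⌉ - 1 := by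
      have : ⌊τ⌋ < ⌈s0 + i * n⌉ := Int.lt_ceil.2 (lt_of_le_of_lt (Int.floor_le τ) hi.1)
      omega
    have d4 := h.nodrop _ _ d3
    have d5 : (1 : ℝ) < ((m0 + i : ℤ) : ℝ) := by push_cast; nlinarith
    have d6 : (1 : ℤ) < m0 + i := by exact_mod_cast d5
    have d7 : (2 : ℝ) ≤ ((m0 + i : ℤ) : ℝ) := by exact_mod_cast d6
    push_cast at d7
    nlinarith
  · intro k hk
    have e0 : ⌈τ + n⌉ = ⌈τ⌉ + n := Int.ceil_add_natCast τ n
    rw [e0] at hk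
    have e1 : ⌊s0 + i * n⌋ + (k : ℤ) ≤ (⌈τ⌉ - 1) + n := by omega
    have := h.nodrop _ _ e1
    rw [h.tper] at this
    linarith

lemma osc {L : Set ℂ} {n' : ℕ} {V' : ℤ → ℂ} {r' θ' : ℤ → ℝ} (h : PC K n V r θ)
    (h' : PC L n' V' r' θ') {x : ℂ} (hx : x ∉ K + L) {φ : ℝ × ℝ → ℝ} (hφ : Continuous φ)
    (hA : ∀ z, Ang (pp V r θ z.1 + pp V' r' θ' z.2 - x) (φ z)) :
    ∃ a b, b < a + 2 * π ∧ ∀ z, a ≤ φ z ∧ φ z ≤ b := by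
  have hpi := Real.pi_pos
  have y1 : ∀ t, x - pp V' r' θ' t ∉ K := fun t hK => hx
    ⟨_, hK, _, h'.curve_mem t, by simp⟩
  have y2 : ∀ s, x - pp V r θ s ∉ L := fun s hL => hx
    ⟨_, h.curve_mem s, _, hL, by simp⟩
  have c1 : ∀ t, Continuous fun s => φ (s, t) := fun t => by fun_prop
  have c2 : ∀ s, Continuous fun t => φ (s, t) := fun s => by fun_prop
  have A1 : ∀ t s, Ang (pp V r θ s - (x - pp V' r' θ' t)) (φ (s, t)) := fun t s => by
    have := hA (s, t)
    rwa [show pp V r θ s - (x - pp V' r' θ' t) = pp V r θ s + pp V' r' θ' t - x by ring]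
  have A2 : ∀ s t, Ang (pp V' r' θ' t - (x - pp V r θ s)) (φ (s, t)) := fun s t => by
    have := hA (s, t)
    rwa [show pp V' r' θ' t - (x - pp V r θ s) = pp V r θ s + pp V' r' θ' t - x by ring]
  have P1 : ∀ s t (m : ℤ), φ (s + m * n, t) = φ (s, t) := fun s t m => by
    have : Function.Periodic (fun s => φ (s, t)) (n : ℝ) := h.curve_per (y1 t) (c1 t) (A1 t)
    exact (this.int_mul m) s
  have P2 : ∀ s t (m : ℤ), φ (s, t + m * n') = φ (s, t) := fun s t m => by
    have : Function.Periodic (fun t => φ (s, t)) (n' : ℝ) := h'.curve_per (y2 s) (c2 s) (A2 s)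
    exact (this.int_mul m) t
  have hcomp : IsCompact (Icc (0 : ℝ) n ×ˢ Icc (0 : ℝ) n') := isCompact_Icc.prod isCompact_Icc
  have hne : (Icc (0 : ℝ) n ×ˢ Icc (0 : ℝ) n').Nonempty :=
    ⟨(0, 0), ⟨le_rfl, h.npos.le⟩, ⟨le_rfl, h'.npos.le⟩⟩
  have red : ∀ z : ℝ × ℝ, ∃ w ∈ Icc (0 : ℝ) n ×ˢ Icc (0 : ℝ) n', φ z = φ w := by
    rintro ⟨s, t⟩
    obtain ⟨i, hi, -⟩ := existsUnique_add_zsmul_mem_Ico h.npos s 0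
    obtain ⟨j, hj, -⟩ := existsUnique_add_zsmul_mem_Ico h'.npos t 0
    rw [zsmul_eq_mul, zero_add] at hi hj
    exact ⟨(s + i * n, t + j * n'), ⟨⟨hi.1, hi.2.le⟩, ⟨hj.1, hj.2.le⟩⟩, by rw [P1, P2]⟩
  obtain ⟨⟨s1, t1⟩, -, hmax⟩ := hcomp.exists_isMaxOn hne hφ.continuousOn
  obtain ⟨⟨s0, t0⟩, -, hmin⟩ := hcomp.exists_isMinOn hne hφ.continuousOn
  have hmax' : ∀ z, φ z ≤ φ (s1, t1) := fun z => by
    obtain ⟨w, hw, e⟩ := red z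
    rw [e]; exact hmax hw
  have hmin' : ∀ z, φ (s0, t0) ≤ φ z := fun z => by
    obtain ⟨w, hw, e⟩ := red z
    rw [e]; exact hmin hw
  refine ⟨φ (s0, t0), φ (s1, t1), ?_, fun z => ⟨hmin' z, hmax' z⟩⟩
  set a := φ (s0, t0) with ha
  set b := φ (s1, t1) with hb
  by_contra hcon
  push Not at hcon
  obtain ⟨σ, ε, i, j, hσ, hε, hle, hst, hen⟩ := h.arc hcon
    (h.at_max (y1 t1) (c1 t1) (A1 t1) (fun s => hmax' (s, t1)))
    (h.at_min (y1 t0) (c1 t0) (A1 t0) (fun s => hmin' (s, t0)))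
  obtain ⟨σ', ε', i', j', hσ', hε', hle', hst', hen'⟩ := h'.arc hcon
    (h'.at_max (y2 s1) (c2 s1) (A2 s1) (fun t => hmax' (s1, t)))
    (h'.at_min (y2 s0) (c2 s0) (A2 s0) (fun t => hmin' (s0, t)))
  have n1 : ∀ t s, pp V r θ s - (x - pp V' r' θ' t) ≠ 0 := fun t s h0 => y1 t (by
    rw [← sub_eq_zero.1 h0]; exact h.curve_mem s)
  have n2 : ∀ s t, pp V' r' θ' t - (x - pp V r θ s) ≠ 0 := fun s t h0 => y2 s (by
    rw [← sub_eq_zero.1 h0]; exact h'.curve_mem t)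
  have f0 : φ (uu σ ε 0, uu σ' ε' 0) = a := by
    rw [uu_zero, uu_zero, hσ, hσ', P1, P2]
  have fN : φ (uu σ ε (⌈ε⌉ - ⌊σ⌋).toNat, uu σ' ε' (⌈ε'⌉ - ⌊σ'⌋).toNat) = b := by
    rw [uu_end hle, uu_end hle', hε, hε', P1, P2]
  have := merge (A := fun k => θ (⌊σ⌋ + k)) (B := fun k => θ' (⌊σ'⌋ + k))
    (N := (⌈ε⌉ - ⌊σ⌋).toNat) (N' := (⌈ε'⌉ - ⌊σ'⌋).toNat) (C := b + 4 * π)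
    (f := fun k l => φ (uu σ ε k, uu σ' ε' l) + 4 * π) hen
    (fun i i' hii _ => h.nodrop _ _ (by omega)) hen'
    (fun i i' hii _ => h'.nodrop _ _ (by omega))
    (fun k hk l M m1 m2 m3 => by
      obtain ⟨u1, u2, u3⟩ := uu_step hk
      exact h.edge_step (c1 _) (A1 _) (n1 _) u1 u2 u3 m1 m2 m3)
    (fun k hk l M m1 m2 m3 => by
      obtain ⟨u1, u2, u3⟩ := uu_step hk
      exact h'.edge_step (c2 _) (A2 _) (n2 _) u1 u2 u3 m1 m2 m3)
    _ 0 0 (θ ⌊σ⌋) (θ' ⌊σ'⌋) rfl (Nat.zero_le _) (Nat.zero_le _)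
    (by simp only [f0]; linarith)
    (fun hN => ⟨by simp, by simpa using hen 0 hN, by simp only [f0]; exact hst,
      fun i' _ _ => h.nodrop _ _ (by omega)⟩)
    (fun hN => ⟨by simp, by simpa using hen' 0 hN, by simp only [f0]; exact hst',
      fun i' _ _ => h'.nodrop _ _ (by omega)⟩)
  simp only [fN] at this
  exact lt_irrefl _ this

end PC
end MS

namespace MS

lemma ext_preconn (R : ℝ) (hR : 0 ≤ R) : IsPreconnected {z : ℂ | R < ‖z‖} := by
  have : {z : ℂ | R < ‖z‖} = (fun q : ℝ × ℝ => (q.1 : ℂ) * cis q.2) '' (Ioi R ×ˢ univ) := by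
    ext z
    simp only [mem_ofPred_eq, mem_image, mem_prod, mem_Ioi, mem_univ, and_true, Prod.exists]
    constructor
    · intro h
      refine ⟨‖z‖, z.arg, h, ?_⟩
      simp [cis]
    · rintro ⟨a, b, h, rfl⟩
      rw [norm_real_cis, abs_of_pos (by linarith)]; exact h
  rw [this]
  refine ((isPreconnected_Ioi).prod isPreconnected_univ).image _ (Continuous.continuousOn ?_)
  unfold cis
  fun_prop

lemma frontier_add {K L : Set ℂ} (hK : IsCompact K) (hL : IsCompact L) :
    frontier (K + L) ⊆ frontier K + frontier L := by
  intro z hz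
  have hc : IsClosed (K + L) := (hK.add hL).isClosed
  have hzK : z ∈ K + L := hc.frontier_subset hz
  obtain ⟨k, hk, l, hl, rfl⟩ := hzK
  have hn : k + l ∉ interior (K + L) := hz.2
  refine ⟨k, ⟨subset_closure hk, fun hi => hn ?_⟩, l, ⟨subset_closure hl, fun hi => hn ?_⟩, rfl⟩
  · exact subset_interior_add_left ⟨k, hi, l, hl, rfl⟩
  · exact subset_interior_add_right ⟨k, hk, l, hi, rfl⟩

theorem PC.sum_compl {K L : Set ℂ} {n n' : ℕ} {V V' : ℤ → ℂ} {r θ r' θ' : ℤ → ℝ}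
    (h : PC K n V r θ) (h' : PC L n' V' r' θ') : IsConnected (K + L)ᶜ := by
  have hcp : IsCompact (K + L) := h.compact.add h'.compact
  obtain ⟨R, hR0, hR⟩ := hcp.isBounded.exists_pos_norm_le
  have hext : {z : ℂ | R < ‖z‖} ⊆ (K + L)ᶜ := fun z hz hzK => absurd (hR z hzK) (not_le.2 hz)
  have hx0 : ((R + 1 : ℝ) : ℂ) ∈ {z : ℂ | R < ‖z‖} := by
    simp only [mem_ofPred_eq, Complex.norm_real, Real.norm_eq_abs]
    rw [abs_of_pos (by linarith)]; linarith
  refine ⟨⟨_, hext hx0⟩, isPreconnected_of_forall ((R + 1 : ℝ) : ℂ) ?_⟩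
  intro x hx
  have hF : ∀ z : ℝ × ℝ, pp V r θ z.1 + pp V' r' θ' z.2 - x ≠ 0 := by
    intro z hz
    apply hx
    rw [sub_eq_zero] at hz
    rw [← hz]
    exact ⟨_, h.curve_mem _, _, h'.curve_mem _, rfl⟩
  have hFc : Continuous fun z : ℝ × ℝ => pp V r θ z.1 + pp V' r' θ' z.2 - x :=
    ((h.continuous.comp continuous_fst).add (h'.continuous.comp continuous_snd)).sub
      continuous_const
  obtain ⟨φ, hφ, hA⟩ := exists_lift convex_univ isOpen_univ univ_nonempty hFc.continuousOn
    (fun z _ => hF z)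
  obtain ⟨a, b, hab, hb⟩ := h.osc h' hx (continuousOn_univ.1 hφ) (fun z => hA z (mem_univ _))
  obtain ⟨γ, hγ1, hγ2⟩ := exists_between hab
  set ray : Set ℂ := (fun ρ : ℝ => x + ρ * cis γ) '' Ici 0 with hray
  have hrp : IsPreconnected ray :=
    isPreconnected_Ici.image _ (Continuous.continuousOn (by fun_prop))
  have hrx : x ∈ ray := ⟨0, by simp, by simp⟩
  have hrs : ray ⊆ (K + L)ᶜ := by
    intro y hy hyK
    obtain ⟨z, ⟨ρ, hρ, rfl⟩, hzf⟩ := inter_frontier_ne hrp ⟨y, hy, hyK⟩ ⟨x, hrx, hx⟩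
    obtain ⟨p, hp, q, hq, hpq⟩ := frontier_add h.compact h'.compact hzf
    rw [h.fr] at hp
    rw [h'.fr] at hq
    obtain ⟨s, rfl⟩ := hp
    obtain ⟨t, rfl⟩ := hq
    have h1 := hA (s, t) (mem_univ _)
    have e : pp V r θ s + pp V' r' θ' t - x = ρ * cis γ := by
      simp only at hpq
      rw [hpq]; ring
    have h2 := ang_cis (φ := γ) (r := ρ) hρ
    have h0 := hF (s, t)
    simp only [e] at h1 h0
    obtain ⟨m, hm⟩ := ang_unique h0 h1 h2
    have h3 := hb (s, t)
    have hpi := Real.pi_pos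
    have l1 : (0 : ℝ) < m ∨ (m : ℝ) ≤ 0 := lt_or_ge _ _
    rcases lt_trichotomy m 0 with hm0 | hm0 | hm0
    · have : (m : ℝ) ≤ -1 := by exact_mod_cast (by omega : m ≤ -1)
      nlinarith
    · subst hm0
      simp at hm
      linarith
    · have : (1 : ℝ) ≤ m := by exact_mod_cast (by omega : 1 ≤ m)
      nlinarith
  refine ⟨ray ∪ {z : ℂ | R < ‖z‖}, union_subset hrs hext, Or.inr hx0, Or.inl hrx, ?_⟩
  have hρ : (0 : ℝ) ≤ R + ‖x‖ + 1 := by positivity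
  refine hrp.union (x + ((R + ‖x‖ + 1 : ℝ) : ℂ) * cis γ) ⟨_, hρ, rfl⟩ ?_ (ext_preconn R hR0.le)
  have := norm_sub_le (x + ((R + ‖x‖ + 1 : ℝ) : ℂ) * cis γ) x
  rw [add_sub_cancel_left, norm_real_cis, abs_of_nonneg hρ] at this
  simp only [mem_ofPred_eq]
  linarith

end MS

namespace MS

/-- The identification of `ℝ × ℝ` with `ℂ`. -/
def cc : (ℝ × ℝ) ≃L[ℝ] ℂ := Complex.equivRealProdCLM.symm

lemma cc_apply (v : ℝ × ℝ) : cc v = v.1 + v.2 * Complex.I := by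
  apply Complex.ext
  · simpa [cc] using Complex.equivRealProdCLM_symm_apply_re v
  · simpa [cc] using Complex.equivRealProdCLM_symm_apply_im v

lemma vangle_eq (v w : ℝ × ℝ) : vangle v w = Complex.arg (cc w / cc v) := by
  rw [vangle, cc_apply, cc_apply]

lemma cc_ne {v : ℝ × ℝ} (h : v ≠ 0) : cc v ≠ 0 := by simpa using h

lemma vangle_lt {v w : ℝ × ℝ} (hv : v ≠ 0) (h : ¬ Opp v w) : |vangle v w| < π := by
  rw [vangle_eq, abs_lt]
  refine ⟨Complex.neg_pi_lt_arg _, lt_of_le_of_ne (Complex.arg_le_pi _) fun he => h ?_⟩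
  rw [Complex.arg_eq_pi_iff] at he
  refine ⟨(cc w / cc v).re, he.1, cc.injective ?_⟩
  have e : cc w / cc v = ((cc w / cc v).re : ℂ) := by
    apply Complex.ext <;> simp [he.2]
  rw [map_smul, Complex.real_smul, ← e, div_mul_cancel₀ _ (cc_ne hv)]

lemma rotShifts_eq (t : List (ℝ × ℝ)) : rotShifts t =
    ∑ j ∈ Finset.range (t.length - 1), vangle (t.getD j 0) (t.getD (j + 1) 0) := by
  induction t with
  | nil => simp [rotShifts]
  | cons a t ih =>
    cases t with
    | nil => simp [rotShifts]
    | cons b t =>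
      rw [rotShifts, ih]
      simp only [List.length_cons, Nat.add_sub_cancel]
      rw [Finset.sum_range_succ', add_comm]
      rfl

/-- The periodic extension of the shift sequence. -/
def ws (s : List (ℝ × ℝ)) (i : ℕ) : ℝ × ℝ := s.getD (i % s.length) 0

/-- The lifted direction of the shifts. -/
def TT' (s : List (ℝ × ℝ)) (i : ℕ) : ℝ :=
  Complex.arg (cc (ws s 0)) + ∑ j ∈ Finset.range i, vangle (ws s j) (ws s (j + 1))

lemma ws_add (s : List (ℝ × ℝ)) (i : ℕ) : ws s (i + s.length) = ws s i := by
  simp [ws]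

lemma ws_app (s : List (ℝ × ℝ)) {i : ℕ} (h : i < 2 * s.length) : (s ++ s).getD i 0 = ws s i := by
  unfold ws
  by_cases hi : i < s.length
  · rw [Nat.mod_eq_of_lt hi, List.getD_append _ _ _ _ hi]
  · push Not at hi
    rw [List.getD_append_right _ _ _ _ hi, Nat.mod_eq_sub_mod hi, Nat.mod_eq_of_lt (by omega)]

lemma ws_app1 (s : List (ℝ × ℝ)) (hs : s ≠ []) {i : ℕ} (h : i ≤ s.length) :
    (s ++ s.take 1).getD i 0 = ws s i := by
  unfold ws
  rcases h.lt_or_eq with hi | hi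
  · rw [Nat.mod_eq_of_lt hi, List.getD_append _ _ _ _ hi]
  · subst hi
    rw [List.getD_append_right _ _ _ _ le_rfl]
    cases s with
    | nil => exact absurd rfl hs
    | cons a t => simp

section
variable {s : List (ℝ × ℝ)}

lemma ws_mem (hs : s ≠ []) (i : ℕ) : ws s i ∈ s := by
  have : i % s.length < s.length := Nat.mod_lt _ (List.length_pos_iff.2 hs)
  rw [ws, List.getD_eq_getElem _ _ this]
  exact List.getElem_mem _

lemma TT_succ (i : ℕ) : TT' s (i + 1) = TT' s i + vangle (ws s i) (ws s (i + 1)) := by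
  rw [TT', TT', Finset.sum_range_succ]; ring

lemma TT_sub (i d : ℕ) : TT' s (i + d) - TT' s i =
    ∑ j ∈ Finset.range d, vangle (ws s (i + j)) (ws s (i + j + 1)) := by
  rw [TT', TT', Finset.sum_range_add]; ring

lemma ws_mod (i : ℕ) : ws s (i % s.length) = ws s i := by simp [ws]

lemma opp_ws (hs : s ≠ []) (hr : NonReverse (s ++ s.take 1)) (i : ℕ) :
    ¬ Opp (ws s i) (ws s (i + 1)) := by
  have hl : 0 < s.length := List.length_pos_iff.2 hs
  have hlt := Nat.mod_lt i hl
  have h1 : ws s (i + 1) = ws s (i % s.length + 1) := by simp [ws]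
  rw [← ws_mod i, h1]
  have hlen : (s ++ s.take 1).length = s.length + 1 := by
    simp; omega
  have := (List.isChain_iff_getElem.1 hr) (i % s.length) (by omega)
  rw [← ws_app1 s hs hlt.le, ← ws_app1 s hs (Nat.succ_le_of_lt hlt),
    List.getD_eq_getElem _ _ (by omega), List.getD_eq_getElem _ _ (by omega)]
  exact this

lemma TT_per (hs : s ≠ []) (ho : rotClosed s = 2 * π) (i : ℕ) :
    TT' s (i + s.length) = TT' s i + 2 * π := by
  have hl : 0 < s.length := List.length_pos_iff.2 hs
  have h0 : ∑ j ∈ Finset.range s.length, vangle (ws s j) (ws s (j + 1)) = 2 * π := by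
    rw [← ho, rotClosed, rotShifts_eq]
    have hlen : (s ++ s.take 1).length - 1 = s.length := by
      simp; omega
    rw [hlen]
    refine Finset.sum_congr rfl fun j hj => ?_
    rw [Finset.mem_range] at hj
    rw [ws_app1 s hs hj.le, ws_app1 s hs (Nat.succ_le_of_lt hj)]
  induction i with
  | zero => simp [TT', h0]
  | succ i ih =>
    rw [show i + 1 + s.length = i + s.length + 1 by ring, TT_succ, TT_succ, ih, ws_add,
      show i + s.length + 1 = i + 1 + s.length by ring, ws_add]
    ring

lemma TT_ang (hs : s ≠ []) (h0 : ∀ v ∈ s, v ≠ 0) (i : ℕ) : Ang (cc (ws s i)) (TT' s i) := by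
  induction i with
  | zero => simpa [TT'] using ang_arg _
  | succ i ih =>
    rw [TT_succ, vangle_eq]
    have := ang_mul ih (ang_arg (cc (ws s (i + 1)) / cc (ws s i)))
    rwa [mul_div_cancel₀ _ (cc_ne (h0 _ (ws_mem hs i)))] at this

lemma aco_le {t : List (ℝ × ℝ)} (ht : t.length ≤ s.length) (hi : t <:+: s ++ s) :
    acoClosed s ≤ rotShifts t := by
  refine csInf_le (Set.Finite.bddBelow (Set.Finite.image _ ?_)) ⟨t, ⟨ht, hi⟩, rfl⟩
  refine Set.Finite.subset (List.finite_toSet ((s ++ s).sublists)) ?_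
  rintro u ⟨-, hu⟩
  simpa using hu.sublist

lemma TT_drop (hs : s ≠ []) (ho : rotClosed s = 2 * π) (ha : -π < acoClosed s) (d : ℕ) :
    ∀ i, TT' s i - π < TT' s (i + d) := by
  have hl : 0 < s.length := List.length_pos_iff.2 hs
  have hpi := Real.pi_pos
  induction d using Nat.strong_induction_on with
  | _ d ih =>
  intro i
  by_cases hd : s.length ≤ d
  · have := ih (d - s.length) (by omega) i
    have e := TT_per hs ho (i + (d - s.length))
    rw [show i + (d - s.length) + s.length = i + d by omega] at e
    linarith
  · push Not at hd
    have e : TT' s (i + d) - TT' s i = TT' s (i % s.length + d) - TT' s (i % s.length) := by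
      rw [TT_sub, TT_sub]
      refine Finset.sum_congr rfl fun j _ => ?_
      simp [ws, add_assoc]
    have hlt := Nat.mod_lt i hl
    have hlen : (((s ++ s).drop (i % s.length)).take (d + 1)).length = d + 1 := by
      simp; omega
    have h1 := aco_le (s := s) (t := ((s ++ s).drop (i % s.length)).take (d + 1)) (by omega)
      ⟨(s ++ s).take (i % s.length), ((s ++ s).drop (i % s.length)).drop (d + 1), by
        rw [List.append_assoc, List.take_append_drop, List.take_append_drop]⟩
    rw [rotShifts_eq, hlen, Nat.add_sub_cancel] at h1
    have h2 : ∀ j, j ≤ d → (((s ++ s).drop (i % s.length)).take (d + 1)).getD j 0 =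
        ws s (i % s.length + j) := by
      intro j hj
      rw [← ws_app s (by omega), List.getD_eq_getElem _ _ (by omega),
        List.getD_eq_getElem _ _ (by simp; omega)]
      simp
    have h3 : TT' s (i % s.length + d) - TT' s (i % s.length) =
        ∑ j ∈ Finset.range d, vangle ((((s ++ s).drop (i % s.length)).take (d + 1)).getD j 0)
          ((((s ++ s).drop (i % s.length)).take (d + 1)).getD (j + 1) 0) := by
      rw [TT_sub]
      refine Finset.sum_congr rfl fun j hj => ?_
      rw [Finset.mem_range] at hj
      rw [h2 j hj.le, h2 (j + 1) hj]; rfl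
    linarith

end

end MS

namespace MS

section
variable {P : Polyline}

/-- The residue of an integer, as a natural number. -/
def md (n : ℕ) (k : ℤ) : ℕ := (k % n).toNat

lemma md_cast {n : ℕ} (hn : 0 < n) (k : ℤ) : ((md n k : ℕ) : ℤ) = k % n :=
  Int.toNat_of_nonneg (Int.emod_nonneg _ (by omega))

lemma md_lt {n : ℕ} (hn : 0 < n) (k : ℤ) : md n k < n := by
  have := md_cast hn k
  have := Int.emod_lt_of_pos k (by omega : (0 : ℤ) < n)
  omega

lemma md_add {n : ℕ} (k m : ℤ) : md n (k + n * m) = md n k := by simp [md]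

lemma md_nat {n : ℕ} (k : ℕ) : md n k = k % n := by
  unfold md; rw [← Int.natCast_mod]; rfl

lemma md_succ {n : ℕ} (hn : 0 < n) (k : ℤ) : (md n k + 1 < n ∧ md n (k + 1) = md n k + 1) ∨
    (md n k + 1 = n ∧ md n (k + 1) = 0) := by
  have h1 := md_cast hn k
  have h2 := md_cast hn (k + 1)
  have h3 := md_lt hn k
  rw [← Int.emod_add_emod, ← h1] at h2
  rcases Nat.lt_or_ge (md n k + 1) n with h | h
  · left
    rw [Int.emod_eq_of_lt (by omega) (by omega)] at h2
    exact ⟨h, by omega⟩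
  · right
    rw [show ((md n k : ℤ) + 1) = n by omega, Int.emod_self] at h2
    exact ⟨by omega, by omega⟩

/-- Vertices. -/
def VV (P : Polyline) (k : ℤ) : ℂ := cc (P.vert (md P.shifts.length k))
/-- Edge lengths. -/
def RR (P : Polyline) (k : ℤ) : ℝ := ‖cc (ws P.shifts (md P.shifts.length k))‖
/-- Edge directions. -/
def QQ (P : Polyline) (k : ℤ) : ℝ :=
  TT' P.shifts (md P.shifts.length k) + 2 * π * ((k / (P.shifts.length : ℤ) : ℤ) : ℝ)

lemma edge_eq (hp : P.Proper) (k : ℤ) :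
    (RR P k : ℂ) * cis (QQ P k) = cc (ws P.shifts (md P.shifts.length k)) := by
  rw [QQ, cis_add_int, RR]
  exact (TT_ang hp.1 hp.2 _).symm

lemma vert_succ {i : ℕ} (hi : i < P.shifts.length) :
    P.vert (i + 1) = P.vert i + P.shifts.getD i 0 := by
  rw [Polyline.vert, Polyline.vert, List.sum_take_succ _ _ hi, List.getD_eq_getElem _ _ hi,
    add_assoc]

lemma ws_lt {i : ℕ} (hi : i < P.shifts.length) : ws P.shifts i = P.shifts.getD i 0 := by
  rw [ws, Nat.mod_eq_of_lt hi]

lemma vert_len (hc : P.Closed) : P.vert P.shifts.length = P.vert 0 := by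
  have : P.shifts.sum = 0 := hc
  simp [Polyline.vert, this]

lemma VV_step (hp : P.Proper) (hc : P.Closed) (k : ℤ) :
    VV P (k + 1) = VV P k + RR P k * cis (QQ P k) := by
  have hn : 0 < P.shifts.length := List.length_pos_iff.2 hp.1
  rw [edge_eq hp, VV, VV, ws_lt (md_lt hn k), ← map_add, ← vert_succ (md_lt hn k)]
  rcases md_succ hn k with h | h
  · rw [h.2]
  · rw [h.2, h.1, vert_len hc]

lemma QQ_per (hp : P.Proper) (k m : ℤ) : QQ P (k + P.shifts.length * m) = QQ P k + 2 * π * m := by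
  have hn : 0 < P.shifts.length := List.length_pos_iff.2 hp.1
  rw [QQ, QQ, md_add, Int.add_mul_ediv_left _ _ (by omega)]
  push_cast; ring

lemma QQ_nat (hp : P.Proper) (ho : rotClosed P.shifts = 2 * π) (k : ℕ) :
    QQ P k = TT' P.shifts k := by
  have hn : 0 < P.shifts.length := List.length_pos_iff.2 hp.1
  have key : ∀ m i : ℕ, TT' P.shifts (i + P.shifts.length * m) = TT' P.shifts i + 2 * π * m := by
    intro m i
    induction m with
    | zero => simp
    | succ m ih =>
      rw [show i + P.shifts.length * (m + 1) = i + P.shifts.length * m + P.shifts.length by ring,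
        TT_per hp.1 ho, ih]
      push_cast; ring
  have := key (k / P.shifts.length) (k % P.shifts.length)
  rw [Nat.mod_add_div] at this
  rw [QQ, md_nat, this]
  norm_cast

lemma exists_nat_shift {n : ℕ} (hn : 0 < n) (k : ℤ) : ∃ (i : ℕ) (m : ℤ), k = i + n * m :=
  ⟨md n k, k / n, by rw [md_cast hn, Int.emod_add_mul_ediv]⟩

lemma QQ_turn (hp : P.Proper) (ho : rotClosed P.shifts = 2 * π)
    (hr : NonReverse (P.shifts ++ P.shifts.take 1)) (k : ℤ) : |QQ P (k + 1) - QQ P k| < π := by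
  obtain ⟨i, m, rfl⟩ := exists_nat_shift (List.length_pos_iff.2 hp.1) k
  have e : ((i : ℤ) + P.shifts.length * m + 1) = ((i + 1 : ℕ) : ℤ) + P.shifts.length * m := by
    push_cast; ring
  rw [e, QQ_per hp, QQ_per hp, QQ_nat hp ho, QQ_nat hp ho, TT_succ,
    show ∀ a b c : ℝ, a + b + c - (a + c) = b by intros; ring]
  exact vangle_lt (hp.2 _ (ws_mem hp.1 i)) (opp_ws hp.1 hr i)

lemma QQ_drop (hp : P.Proper) (ho : rotClosed P.shifts = 2 * π)
    (ha : -π < acoClosed P.shifts) (k l : ℤ) (hkl : k ≤ l) : QQ P k - π < QQ P l := by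
  obtain ⟨i, m, rfl⟩ := exists_nat_shift (List.length_pos_iff.2 hp.1) k
  obtain ⟨d, rfl⟩ := Int.le.dest hkl
  have e : ((i : ℤ) + P.shifts.length * m + d) = ((i + d : ℕ) : ℤ) + P.shifts.length * m := by
    push_cast; ring
  rw [e, QQ_per hp, QQ_per hp, QQ_nat hp ho, QQ_nat hp ho]
  have := TT_drop hp.1 ho ha d i
  linarith

lemma three_le (hp : P.Proper) (hc : P.Closed)
    (hr : NonReverse (P.shifts ++ P.shifts.take 1)) : 3 ≤ P.shifts.length := by
  obtain ⟨st, s⟩ := P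
  have h1 := hp.1
  have h2 := hp.2
  have h3 : s.sum = 0 := hc
  simp only at *
  match s with
  | [] => exact absurd rfl h1
  | [v] =>
    simp at h3
    exact absurd h3 (h2 v (by simp))
  | [v, w] =>
    simp at h3
    have := opp_ws h1 hr 0
    refine absurd ⟨-1, by norm_num, ?_⟩ this
    simp [ws]
    exact eq_neg_of_add_eq_zero_right h3
  | _ :: _ :: _ :: _ => simp

lemma pp_eq (hp : P.Proper) (u : ℝ) (m : ℤ) (h0 : 0 ≤ u) (h1 : u < P.shifts.length) :
    pp (VV P) (RR P) (QQ P) (u + P.shifts.length * m) = cc (P.param u) := by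
  have hf : ⌊u + (P.shifts.length : ℝ) * m⌋ = ⌊u⌋ + P.shifts.length * m := by
    have := Int.floor_add_intCast u (P.shifts.length * m)
    push_cast at this
    exact this
  have hfr : Int.fract (u + (P.shifts.length : ℝ) * m) = Int.fract u := by
    have := Int.fract_add_intCast u (P.shifts.length * m)
    push_cast at this
    exact this
  have hfl0 : 0 ≤ ⌊u⌋ := Int.floor_nonneg.2 h0
  have hfl1 : ⌊u⌋ < P.shifts.length := Int.floor_lt.2 (by exact_mod_cast h1)
  have hmd : md P.shifts.length ⌊u⌋ = ⌊u⌋.toNat := by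
    rw [md, Int.emod_eq_of_lt hfl0 hfl1]
  have hlt : ⌊u⌋.toNat < P.shifts.length := by omega
  rw [pp, edge_eq hp, hf, hfr, VV, md_add, hmd, ws_lt hlt, Polyline.param, map_add, map_smul,
    Complex.real_smul]

lemma exists_shift {n : ℕ} (hn : 0 < n) (t : ℝ) : ∃ (u : ℝ) (m : ℤ),
    t = u + n * m ∧ 0 ≤ u ∧ u < n := by
  have hn' : (0 : ℝ) < n := by exact_mod_cast hn
  have h1 := Int.floor_le (t / n)
  have h2 := Int.lt_floor_add_one (t / n)
  rw [le_div_iff₀ hn'] at h1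
  rw [div_lt_iff₀ hn'] at h2
  exact ⟨t - n * ⌊t / n⌋, ⌊t / n⌋, by ring, by linarith, by linarith⟩

lemma range_eq (hp : P.Proper) (hc : P.Closed) :
    range (pp (VV P) (RR P) (QQ P)) = cc '' P.trace := by
  have hn : 0 < P.shifts.length := List.length_pos_iff.2 hp.1
  have hn' : (0 : ℝ) < P.shifts.length := by exact_mod_cast hn
  ext z
  constructor
  · rintro ⟨t, rfl⟩
    obtain ⟨u, m, rfl, h0, h1⟩ := exists_shift hn t
    rw [pp_eq hp u m h0 h1]
    exact ⟨_, ⟨u, ⟨h0, h1.le⟩, rfl⟩, rfl⟩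
  · rintro ⟨_, ⟨u, ⟨h0, h1⟩, rfl⟩, rfl⟩
    rcases h1.lt_or_eq with h1 | h1
    · exact ⟨_, pp_eq hp u 0 h0 h1⟩
    · refine ⟨_, (pp_eq hp 0 0 le_rfl hn').trans ?_⟩
      subst h1
      congr 1
      simp [Polyline.param, vert_len hc]

theorem toPC {K : Set (ℝ × ℝ)} (h : IsSimplePolygon K P) (ha : -π < acoClosed P.shifts) :
    PC (cc '' K) P.shifts.length (VV P) (RR P) (QQ P) where
  hn := three_le h.proper h.simpleClosed.1 h.nonReverse
  Vper k := by
    have := md_add (n := P.shifts.length) k 1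
    rw [mul_one] at this
    rw [VV, VV, this]
  rpos k := norm_pos_iff.2 (cc_ne (h.proper.2 _ (ws_mem h.proper.1 _)))
  step k := VV_step h.proper h.simpleClosed.1 k
  tper k := by
    have := QQ_per h.proper k 1
    simpa using this
  turn k := QQ_turn h.proper h.orient h.nonReverse k
  nodrop k l hkl := QQ_drop h.proper h.orient ha k l hkl
  compact := h.compact.image cc.continuous
  regular := by
    have h1 := cc.toHomeomorph.image_interior K
    have h2 := cc.toHomeomorph.image_closure (interior K)
    rw [h1, ← h.regular] at h2
    exact h2
  fr := by
    rw [range_eq h.proper h.simpleClosed.1, ← h.boundary]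
    exact (cc.toHomeomorph.image_frontier K).symm
  inj t t' he := by
    have hn : 0 < P.shifts.length := List.length_pos_iff.2 h.proper.1
    obtain ⟨u, m, rfl, h0, h1⟩ := exists_shift hn t
    obtain ⟨u', m', rfl, h0', h1'⟩ := exists_shift hn t'
    rw [pp_eq h.proper u m h0 h1, pp_eq h.proper u' m' h0' h1'] at he
    have := h.simpleClosed.2 ⟨h0, h1⟩ ⟨h0', h1'⟩ (cc.injective he)
    subst this
    exact ⟨m - m', by push_cast; ring⟩

end

end MS

/-- If `K` and `L` are simple polygons with `aco K, aco L > -π`, then the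
Minkowski sum `K + L` has no holes: its complement is connected. -/
theorem minkowski_sum_no_holes (K L : Set (ℝ × ℝ)) (P Q : Polyline)
    (hK : IsSimplePolygon K P) (hL : IsSimplePolygon L Q)
    (hacoK : -π < acoClosed P.shifts) (hacoL : -π < acoClosed Q.shifts) :
    IsConnected ((K + L)ᶜ) := by
  have h := (MS.toPC hK hacoK).sum_compl (MS.toPC hL hacoL)
  rw [← Set.image_add, ← Set.image_compl_eq MS.cc.bijective] at h
  have h2 := h.image MS.cc.symm MS.cc.symm.continuous.continuousOn
  rw [Set.image_image] at h2
  simpa using h2
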